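/- Under assumptions (A1)–(A4), let μ⋆ be the unique stationary Borel probability measure on (0,1). Then the Markov operator P is asymptotically stable: for every Borel probability measure ν on (0,1) the measures Pⁿν converge weakly to μ⋆; equivalently, for every bounded continuous φ : (0,1) → ℝ, ∫ Uⁿφ dν → ∫ φ dμ⋆ as n → ∞. -/

import Mathlib

/-
Formalization of the Alsedà–Misiurewicz system setup:
`f0, f1` are the piecewise-linear interval homeomorphisms, `iter` the random
iteration along ω ∈ Σ = {0,1}^ℕ, `IsKernel` characterises the family x ↦ ℙ_x by
its values on cylinder sets, `Pop` is the Markov operator (as a set function),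
`Stationary` expresses P-invariance for probability measures on (0,1), `U` is
the dual operator, and `A1`–`A4` are the assumptions of the paper.
-/

open MeasureTheory Filter Set
open scoped ENNReal Topology

namespace AM

noncomputable def f0 (x₀ y₀ : ℝ) (x : ℝ) : ℝ :=
  if x ≤ x₀ then (y₀ / x₀) * x else ((1 - y₀) / (1 - x₀)) * (x - 1) + 1

noncomputable def f1 (x₀ y₀ : ℝ) (x : ℝ) : ℝ := 1 - f0 x₀ y₀ (1 - x)

/-- `fb b` is `f₁` if `b = true`, and `f₀` if `b = false`. -/
noncomputable def fb (x₀ y₀ : ℝ) (b : Bool) : ℝ → ℝ :=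
  if b then f1 x₀ y₀ else f0 x₀ y₀

/-- `iter x₀ y₀ ω n x = f^n_ω(x) = f_{ω (n-1)} ∘ ⋯ ∘ f_{ω 0} (x)`, with `f^0_ω = id`. -/
noncomputable def iter (x₀ y₀ : ℝ) (ω : ℕ → Bool) : ℕ → ℝ → ℝ
  | 0, x => x
  | n + 1, x => fb x₀ y₀ (ω n) (iter x₀ y₀ ω n x)

/-- `cylProb x₀ y₀ p₀ p₁ x w = p_{i₁}(x) p_{i₂}(f_{i₁} x) ⋯` for the word `w = (i₁, …, i_k)`. -/
noncomputable def cylProb (x₀ y₀ : ℝ) (p₀ p₁ : ℝ → ℝ) : ℝ → List Bool → ℝ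
  | _, [] => 1
  | x, b :: w => (if b then p₁ x else p₀ x) * cylProb x₀ y₀ p₀ p₁ (fb x₀ y₀ b x) w

/-- The cylinder set of sequences starting with the word `w`. -/
def cyl (w : List Bool) : Set (ℕ → Bool) := {ω | ∀ j : Fin w.length, ω j = w.get j}

/-- `IsKernel x₀ y₀ p₀ p₁ Pm` says that `Pm x = ℙ_x` for all `x ∈ (0,1)`, i.e. `Pm x` gives
every cylinder set its prescribed probability (this determines `Pm x` uniquely and makes it a
probability measure, since the empty word gives `Pm x univ = 1`). -/
def IsKernel (x₀ y₀ : ℝ) (p₀ p₁ : ℝ → ℝ) (Pm : ℝ → Measure (ℕ → Bool)) : Prop :=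
  ∀ x ∈ Ioo (0:ℝ) 1, ∀ w : List Bool,
    Pm x (cyl w) = ENNReal.ofReal (cylProb x₀ y₀ p₀ p₁ x w)

/-- The Markov operator `P`, as a set function:
`Pop μ A = ∫_{f₀⁻¹(A)} p₀ dμ + ∫_{f₁⁻¹(A)} p₁ dμ`. -/
noncomputable def Pop (x₀ y₀ : ℝ) (p₀ p₁ : ℝ → ℝ) (μ : Measure ℝ) (A : Set ℝ) : ℝ≥0∞ :=
  (∫⁻ x in f0 x₀ y₀ ⁻¹' A, ENNReal.ofReal (p₀ x) ∂μ) +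
    ∫⁻ x in f1 x₀ y₀ ⁻¹' A, ENNReal.ofReal (p₁ x) ∂μ

/-- A stationary (P-invariant) Borel probability measure on (0,1). -/
def Stationary (x₀ y₀ : ℝ) (p₀ p₁ : ℝ → ℝ) (μ : Measure ℝ) : Prop :=
  IsProbabilityMeasure μ ∧ μ (Ioo 0 1) = 1 ∧
    ∀ A : Set ℝ, MeasurableSet A → A ⊆ Ioo 0 1 → μ A = Pop x₀ y₀ p₀ p₁ μ A

/-- The dual operator `Uφ(x) = p₀(x) φ(f₀ x) + p₁(x) φ(f₁ x)`. -/
noncomputable def U (x₀ y₀ : ℝ) (p₀ p₁ : ℝ → ℝ) (φ : ℝ → ℝ) : ℝ → ℝ :=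
  fun x => p₀ x * φ (f0 x₀ y₀ x) + p₁ x * φ (f1 x₀ y₀ x)

/-- Assumption (A1): `1/2 < x₀ < 1` and `1/2 ≤ y₀ < x₀`. -/
def A1 (x₀ y₀ : ℝ) : Prop := 1/2 < x₀ ∧ x₀ < 1 ∧ 1/2 ≤ y₀ ∧ y₀ < x₀

/-- Assumption (A2): Dini continuity of `p₀, p₁`; `β` is a modulus of continuity for both, with
`∑ₙ β(C tⁿ) < ∞` for all `C ≥ 0`, `0 < t < 1`. (Such a `β` exists iff the least modulus of
continuity has this summability property.) -/
def A2 (p₀ p₁ : ℝ → ℝ) : Prop :=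
  ∃ β : ℝ → ℝ,
    (∀ t : ℝ, ∀ x ∈ Icc (0:ℝ) 1, ∀ y ∈ Icc (0:ℝ) 1, |x - y| ≤ t →
      |p₀ x - p₀ y| ≤ β t ∧ |p₁ x - p₁ y| ≤ β t) ∧
    (∀ C : ℝ, 0 ≤ C → ∀ t : ℝ, 0 < t → t < 1 → Summable fun n : ℕ => β (C * t ^ n))

/-- Assumption (A3): `p₀, p₁` are continuous, `p₀ + p₁ = 1`, and `0 < pᵢ < 1` on `[0,1]`. -/
def A3 (p₀ p₁ : ℝ → ℝ) : Prop :=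
  ContinuousOn p₀ (Icc 0 1) ∧ ContinuousOn p₁ (Icc 0 1) ∧
    ∀ x ∈ Icc (0:ℝ) 1, p₀ x + p₁ x = 1 ∧ 0 < p₀ x ∧ p₀ x < 1 ∧ 0 < p₁ x ∧ p₁ x < 1

/-- Assumption (A4): the average Lyapunov exponents at 0 and 1 are positive
(`a₀ = y₀/x₀`, `a₁ = (1-y₀)/(1-x₀)`). -/
def A4 (x₀ y₀ : ℝ) (p₀ p₁ : ℝ → ℝ) : Prop :=
  0 < p₀ 0 * Real.log (y₀ / x₀) + p₁ 0 * Real.log ((1 - y₀) / (1 - x₀)) ∧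
    0 < p₀ 1 * Real.log ((1 - y₀) / (1 - x₀)) + p₁ 1 * Real.log (y₀ / x₀)

end AM

/-- The averaging operator of a finite family of maps `F i` chosen with place-dependent
weights `q i`. -/
noncomputable def mop {ι X : Type*} [Fintype ι] (F : ι → X → X) (q : ι → X → ℝ)
    (ψ : X → ℝ) : X → ℝ :=
  fun x => ∑ i, q i x * ψ (F i x)

/-- Composition of the maps `F i` along a word, the head of the word being applied first. -/
def run {ι X : Type*} (F : ι → X → X) : List ι → X → X
  | [], x => x
  | i :: w, x => run F w (F i x)

/-- Place-dependent probability weights. -/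
structure IsWeight {ι X : Type*} [Fintype ι] (q : ι → X → ℝ) : Prop where
  nonneg : ∀ i x, 0 ≤ q i x
  sum_one : ∀ x, ∑ i, q i x = 1

section Operator

variable {ι X : Type*}

theorem run_append (F : ι → X → X) (w w' : List ι) (x : X) :
    run F (w ++ w') x = run F w' (run F w x) := by
  induction w generalizing x with
  | nil => rfl
  | cons i w ih => exact ih (F i x)

variable [Fintype ι] {F : ι → X → X} {q : ι → X → ℝ}

theorem mop_iterate_mono_on (hq : IsWeight q) {S : Set X} (hS : ∀ i, ∀ x ∈ S, F i x ∈ S)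
    {ψ ψ' : X → ℝ} (h : ∀ x ∈ S, ψ x ≤ ψ' x) (n : ℕ) :
    ∀ x ∈ S, (mop F q)^[n] ψ x ≤ (mop F q)^[n] ψ' x := by
  induction n with
  | zero => exact h
  | succ n ih =>
    intro x hx
    rw [Function.iterate_succ_apply', Function.iterate_succ_apply']
    exact Finset.sum_le_sum fun i _ =>
      mul_le_mul_of_nonneg_left (ih _ (hS i x hx)) (hq.nonneg i x)

theorem mop_iterate_const (hq : IsWeight q) (c : ℝ) (n : ℕ) :
    (mop F q)^[n] (fun _ => c) = fun _ => c := by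
  induction n with
  | zero => rfl
  | succ n ih =>
    rw [Function.iterate_succ_apply', ih]
    funext x
    simp only [mop]
    rw [← Finset.sum_mul, hq.sum_one, one_mul]

theorem mop_iterate_linear (a b : ℝ) (ψ χ : X → ℝ) (n : ℕ) :
    (mop F q)^[n] (fun x => a * ψ x + b * χ x) =
      fun x => a * (mop F q)^[n] ψ x + b * (mop F q)^[n] χ x := by
  induction n with
  | zero => rfl
  | succ n ih =>
    rw [Function.iterate_succ_apply', ih, Function.iterate_succ_apply',
      Function.iterate_succ_apply']
    funext x
    simp only [mop]
    rw [Finset.mul_sum, Finset.mul_sum, ← Finset.sum_add_distrib]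
    exact Finset.sum_congr rfl fun i _ => by ring

theorem mop_iterate_le_const (hq : IsWeight q) {S : Set X} (hS : ∀ i, ∀ x ∈ S, F i x ∈ S)
    {ψ : X → ℝ} {c : ℝ} (h : ∀ x ∈ S, ψ x ≤ c) (n : ℕ) {x : X} (hx : x ∈ S) :
    (mop F q)^[n] ψ x ≤ c := by
  have := mop_iterate_mono_on hq hS (ψ' := fun _ => c) h n x hx
  rwa [mop_iterate_const hq] at this

theorem mop_iterate_le_of_word (hq : IsWeight q) {ε : ℝ} (hε : 0 ≤ ε) (hqε : ∀ i x, ε ≤ q i x)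
    {S : Set X} (hS : ∀ i, ∀ x ∈ S, F i x ∈ S) {ψ : X → ℝ} {c s : ℝ} (hs : 0 ≤ s)
    (h : ∀ x ∈ S, ψ x ≤ c) (w : List ι) :
    ∀ x ∈ S, ψ (run F w x) ≤ c - s → (mop F q)^[w.length] ψ x ≤ c - ε ^ w.length * s := by
  induction w with
  | nil =>
    intro x _ hx
    simpa [run] using hx
  | cons i w ih =>
    intro x hx hw
    rw [List.length_cons, Function.iterate_succ_apply']
    have h1 := ih (F i x) (hS i x hx) hw
    have hle : ∀ j, (mop F q)^[w.length] ψ (F j x) ≤ c := fun j =>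
      mop_iterate_le_const hq hS h _ (hS j x hx)
    have h0 : 0 ≤ ε ^ w.length * s := by positivity
    have key : mop F q ((mop F q)^[w.length] ψ) x ≤ c - q i x * (ε ^ w.length * s) := by
      classical
      have : ∑ j, q j x * (mop F q)^[w.length] ψ (F j x) ≤
          ∑ j, (q j x * c - if j = i then q i x * (ε ^ w.length * s) else 0) := by
        refine Finset.sum_le_sum fun j _ => ?_
        by_cases hj : j = i
        · subst hj
          rw [if_pos rfl, ← mul_sub]
          exact mul_le_mul_of_nonneg_left h1 (hq.nonneg _ _)
        · rw [if_neg hj, sub_zero]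
          exact mul_le_mul_of_nonneg_left (hle j) (hq.nonneg _ _)
      refine this.trans (le_of_eq ?_)
      rw [Finset.sum_sub_distrib, ← Finset.sum_mul, hq.sum_one, one_mul]
      simp
    refine key.trans ?_
    have := mul_le_mul_of_nonneg_right (hqε i x) h0
    rw [pow_succ]
    linarith

theorem mop_iterate_drift (hq : IsWeight q) {V : X → ℝ} {l b : ℝ} (hl : 0 ≤ l) (hb : 0 ≤ b)
    (hV : ∀ x, mop F q V x ≤ l * V x + b * (1 - l)) (n : ℕ) (x : X) :
    (mop F q)^[n] V x ≤ l ^ n * V x + b := by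
  have main : (mop F q)^[n] V x ≤ l ^ n * V x + b * (1 - l ^ n) := by
    induction n generalizing x with
    | zero => simp
    | succ n ih =>
      rw [Function.iterate_succ_apply']
      have h1 : ∑ i, q i x * (mop F q)^[n] V (F i x) ≤
          ∑ i, (l ^ n * (q i x * V (F i x)) + q i x * (b * (1 - l ^ n))) := by
        refine Finset.sum_le_sum fun i _ => ?_
        have := mul_le_mul_of_nonneg_left (ih (F i x)) (hq.nonneg i x)
        linarith
      rw [Finset.sum_add_distrib, ← Finset.mul_sum, ← Finset.sum_mul, hq.sum_one,
        one_mul] at h1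
      have h2 := mul_le_mul_of_nonneg_left (hV x) (pow_nonneg hl n)
      refine h1.trans ?_
      simp only [mop] at h2
      rw [pow_succ]
      linarith
  have : 0 ≤ b * l ^ n := by positivity
  linarith

theorem exists_run_le (hq : IsWeight q) {ψ : X → ℝ} {c : ℝ} (n : ℕ) :
    ∀ x, (mop F q)^[n] ψ x ≤ c → ∃ w : List ι, ψ (run F w x) ≤ c := by
  induction n with
  | zero => exact fun x hx => ⟨[], hx⟩
  | succ n ih =>
    intro x hx
    rw [Function.iterate_succ_apply'] at hx
    obtain ⟨i, hi⟩ : ∃ i, (mop F q)^[n] ψ (F i x) ≤ c := by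
      by_contra! hcon
      have h1 : ∑ i, q i x * c < ∑ i, q i x * (mop F q)^[n] ψ (F i x) := by
        refine Finset.sum_lt_sum
          (fun i _ => mul_le_mul_of_nonneg_left (hcon i).le (hq.nonneg i x)) ?_
        have : ∃ i ∈ Finset.univ, 0 < q i x := by
          by_contra! h0
          have := Finset.sum_nonpos h0
          rw [hq.sum_one] at this
          linarith
        obtain ⟨i, hi, hpos⟩ := this
        exact ⟨i, hi, mul_lt_mul_of_pos_left (hcon i) hpos⟩
      rw [← Finset.sum_mul, hq.sum_one, one_mul] at h1
      exact absurd hx (not_le.2 h1)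
    obtain ⟨w, hw⟩ := ih _ hi
    exact ⟨i :: w, hw⟩

end Operator

/-- A place-dependent random system of two nonexpansive maps of the line whose weights have the
Dini modulus `β`, with Lyapunov function `V`, which is contracting along some word near every
point. -/
structure LineSystem (F q : Bool → ℝ → ℝ) (V β : ℝ → ℝ) (ε l b : ℝ) : Prop where
  weight : IsWeight q
  eps_pos : 0 < ε
  eps_le : ∀ i u, ε ≤ q i u
  nonexp : ∀ i u v, |F i u - F i v| ≤ |u - v|
  beta_nonneg : ∀ t, 0 ≤ t → 0 ≤ β t
  beta_mono : ∀ s t, 0 ≤ s → s ≤ t → β s ≤ β t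
  modulus : ∀ i u v, |q i u - q i v| ≤ β |u - v|
  dini : ∀ C t : ℝ, 0 ≤ C → 0 < t → t < 1 → Summable fun n : ℕ => β (C * t ^ n)
  V_nonneg : ∀ u, 0 ≤ V u
  V_proper : ∀ M, ∃ m, ∀ u, V u ≤ M → |u| ≤ m
  V_bdd : ∀ m, ∃ M, ∀ u, |u| ≤ m → V u ≤ M
  l_nonneg : 0 ≤ l
  l_lt : l < 1
  b_nonneg : 0 ≤ b
  drift : ∀ u, mop F q V u ≤ l * V u + b * (1 - l)
  contr : ∀ u, ∃ (w : List Bool) (r θ : ℝ), 0 < r ∧ 0 < θ ∧ θ < 1 ∧ ∀ v v',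
    |v - u| < r → |v' - u| < r → |run F w v - run F w v'| ≤ θ * |v - v'|

namespace LineSystem

variable {F q : Bool → ℝ → ℝ} {V β : ℝ → ℝ} {ε l b : ℝ}

theorem run_nonexp (h : LineSystem F q V β ε l b) (w : List Bool) (u v : ℝ) :
    |run F w u - run F w v| ≤ |u - v| := by
  induction w generalizing u v with
  | nil => exact le_rfl
  | cons i w ih => exact (ih _ _).trans (h.nonexp i u v)

theorem continuous_run (h : LineSystem F q V β ε l b) (w : List Bool) :
    Continuous (run F w) := by
  refine (LipschitzWith.of_dist_le_mul (K := 1) fun u v => ?_).continuous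
  simpa [Real.dist_eq] using h.run_nonexp w u v

theorem exists_run_V_le (h : LineSystem F q V β ε l b) (u : ℝ) :
    ∃ w, V (run F w u) ≤ b + 1 := by
  have ht : Tendsto (fun n : ℕ => l ^ n * V u) atTop (𝓝 (0 * V u)) :=
    (tendsto_pow_atTop_nhds_zero_of_lt_one h.l_nonneg h.l_lt).mul_const _
  rw [zero_mul] at ht
  obtain ⟨n, hn⟩ := (ht.eventually (gt_mem_nhds one_pos)).exists
  refine exists_run_le h.weight n u ?_
  have := mop_iterate_drift h.weight h.l_nonneg h.b_nonneg h.drift n u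
  linarith

theorem exists_run_lt (h : LineSystem F q V β ε l b) {u v : ℝ} (huv : u ≠ v) :
    ∃ w, |run F w u - run F w v| < |u - v| := by
  obtain ⟨w, r, θ, hr, hθ, hθ1, hw⟩ := h.contr u
  have hd : 0 < |v - u| := abs_pos.2 (sub_ne_zero.2 huv.symm)
  set s : ℝ := min 1 (r / (2 * |v - u|)) with hs
  have hs0 : 0 < s := lt_min one_pos (by positivity)
  have hs1 : s ≤ 1 := min_le_left _ _
  have hsr : s * |v - u| < r := by
    have : s ≤ r / (2 * |v - u|) := min_le_right _ _
    rw [le_div_iff₀ (by positivity)] at this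
    linarith
  set c := u + s * (v - u) with hc
  have hcu : |c - u| = s * |v - u| := by
    rw [hc, add_sub_cancel_left, abs_mul, abs_of_pos hs0]
  have hcv : |c - v| = (1 - s) * |v - u| := by
    have : c - v = -((1 - s) * (v - u)) := by rw [hc]; ring
    rw [this, abs_neg, abs_mul, abs_of_nonneg (by linarith)]
  refine ⟨w, ?_⟩
  have h1 := hw u c (by simpa using hr) (by rw [hcu]; exact hsr)
  have h2 := h.run_nonexp w c v
  have h3 := abs_sub_le (run F w u) (run F w c) (run F w v)
  rw [abs_sub_comm u c, hcu] at h1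
  rw [hcv] at h2
  rw [abs_sub_comm u v]
  have : 0 < s * |v - u| := by positivity
  nlinarith

theorem exists_run_close (h : LineSystem F q V β ε l b) (u v : ℝ) {δ : ℝ} (hδ : 0 < δ) :
    ∃ w, |run F w u - run F w v| < δ ∧ V (run F w u) ≤ b + 1 := by
  obtain ⟨m, hm⟩ := h.V_proper (b + 1)
  set O : Set (ℝ × ℝ) := {z | ∃ w, V (run F w u) ≤ b + 1 ∧ z = (run F w u, run F w v)} with hO
  have hOb : O ⊆ Metric.closedBall (0 : ℝ × ℝ) (m + |u - v|) := by
    rintro z ⟨w, hw, rfl⟩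
    have h1 := hm _ hw
    have h2 := h.run_nonexp w u v
    rw [mem_closedBall_zero_iff, Prod.norm_def, max_le_iff]
    simp only [Real.norm_eq_abs]
    refine ⟨by linarith [abs_nonneg (u - v)], ?_⟩
    have := abs_sub_abs_le_abs_sub (run F w v) (run F w u)
    rw [abs_sub_comm] at this
    linarith
  have hcomp : IsCompact (closure O) :=
    (isCompact_closedBall (0 : ℝ × ℝ) (m + |u - v|)).closure_of_subset hOb
  have hne : (closure O).Nonempty := by
    obtain ⟨w, hw⟩ := h.exists_run_V_le u
    exact ⟨_, subset_closure ⟨w, hw, rfl⟩⟩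
  obtain ⟨z, hz, hmin⟩ := hcomp.exists_isMinOn hne
    (f := fun z : ℝ × ℝ => |z.1 - z.2|) (by fun_prop)
  have hgoal : ∀ w c, |run F w z.1 - run F w z.2| < c →
      ∃ w', |run F w' u - run F w' v| < c ∧ V (run F w' u) ≤ b + 1 := by
    intro w c hc
    have hopen : IsOpen {y : ℝ × ℝ | |run F w y.1 - run F w y.2| < c} := by
      have := h.continuous_run w
      exact isOpen_lt (by fun_prop) continuous_const
    obtain ⟨y, hy, w', -, rfl⟩ := mem_closure_iff.1 hz _ hopen hc
    obtain ⟨w'', hw''⟩ := h.exists_run_V_le (run F w (run F w' u))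
    refine ⟨w' ++ (w ++ w''), ?_, ?_⟩
    · rw [run_append, run_append, run_append, run_append]
      exact (h.run_nonexp w'' _ _).trans_lt hy
    · rw [run_append, run_append]
      exact hw''
  rcases eq_or_ne z.1 z.2 with he | he
  · exact hgoal [] δ (by simp [run, he, hδ])
  · obtain ⟨w, hw⟩ := h.exists_run_lt he
    obtain ⟨w', hw', hV'⟩ := hgoal w _ hw
    have := hmin (subset_closure ⟨w', hV', rfl⟩)
    exact absurd hw' (not_lt.2 this)

theorem exists_uniform_word (h : LineSystem F q V β ε l b) (m : ℝ) :
    ∃ (N : ℕ) (r θ : ℝ), 0 < N ∧ 0 < r ∧ 0 < θ ∧ θ < 1 ∧ ∀ u, |u| ≤ m →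
      ∃ w : List Bool, w.length = N ∧ ∀ v, |u - v| < r →
        |run F w u - run F w v| ≤ θ * |u - v| := by
  choose w r θ hr hθ hθ1 hw using h.contr
  obtain ⟨t, ht⟩ := (isCompact_Icc (a := -m) (b := m)).elim_finite_subcover
    (fun u : ℝ => Metric.ball u (r u / 2)) (fun _ => Metric.isOpen_ball)
    (fun u _ => mem_iUnion.2 ⟨u, Metric.mem_ball_self (half_pos (hr u))⟩)
  rcases t.eq_empty_or_nonempty with rfl | hne
  · refine ⟨1, 1, 1 / 2, one_pos, one_pos, by norm_num, by norm_num, fun u hu => ?_⟩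
    simpa using ht (abs_le.1 hu)
  · refine ⟨t.sup (fun u => (w u).length) + 1, t.inf' hne (fun u => r u / 2), t.sup' hne θ,
      Nat.succ_pos _, ?_, ?_, ?_, ?_⟩
    · rw [Finset.lt_inf'_iff]
      exact fun u _ => half_pos (hr u)
    · obtain ⟨x, hx⟩ := hne
      exact (hθ x).trans_le (Finset.le_sup' θ hx)
    · rw [Finset.sup'_lt_iff]
      exact fun u _ => hθ1 u
    · intro u hu
      obtain ⟨x, hx, hux⟩ := mem_iUnion₂.1 (ht (abs_le.1 hu))
      have hlen : (w x).length ≤ t.sup (fun u => (w u).length) :=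
        Finset.le_sup (f := fun u => (w u).length) hx
      refine ⟨w x ++ List.replicate (t.sup (fun u => (w u).length) + 1 - (w x).length) false,
        ?_, fun v hv => ?_⟩
      · rw [List.length_append, List.length_replicate]
        omega
      · rw [run_append, run_append]
        refine (h.run_nonexp _ _ _).trans ?_
        have hrx : |u - v| < r x / 2 := hv.trans_le (Finset.inf'_le _ hx)
        rw [Metric.mem_ball, Real.dist_eq] at hux
        have h1 := hw x u v (by linarith [hr x]) (by
          have := abs_sub_le v u x
          rw [abs_sub_comm v u] at this
          linarith)
        refine h1.trans (mul_le_mul_of_nonneg_right (Finset.le_sup' θ hx) (abs_nonneg _))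

theorem mul_pow_succ_eq (d θ : ℝ) (n : ℕ) : d * θ ^ (n + 1) = (θ * d) * θ ^ n := by ring

theorem dini_sum_eq (h : LineSystem F q V β ε l b) {θ : ℝ} (hθ : 0 < θ) (hθ1 : θ < 1) {d : ℝ}
    (hd : 0 ≤ d) : ∑' k : ℕ, β (d * θ ^ k) = β d + ∑' k : ℕ, β (θ * d * θ ^ k) := by
  rw [(h.dini d θ hd hθ hθ1).tsum_eq_zero_add]
  simp only [mul_pow_succ_eq, pow_zero, mul_one]

theorem dini_sum_nonneg (h : LineSystem F q V β ε l b) {θ : ℝ} (hθ : 0 < θ) {d : ℝ}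
    (hd : 0 ≤ d) : 0 ≤ ∑' k : ℕ, β (d * θ ^ k) :=
  tsum_nonneg fun k => h.beta_nonneg _ (by positivity)

theorem dini_sum_mono (h : LineSystem F q V β ε l b) {θ : ℝ} (hθ : 0 < θ) (hθ1 : θ < 1)
    {d d' : ℝ} (hd : 0 ≤ d) (hdd : d ≤ d') :
    ∑' k : ℕ, β (d * θ ^ k) ≤ ∑' k : ℕ, β (d' * θ ^ k) :=
  (h.dini d θ hd hθ hθ1).tsum_le_tsum
    (fun k => h.beta_mono _ _ (by positivity) (mul_le_mul_of_nonneg_right hdd (by positivity)))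
    (h.dini d' θ (hd.trans hdd) hθ hθ1)

theorem exists_dini_sum_le (h : LineSystem F q V β ε l b) {θ : ℝ} (hθ : 0 < θ) (hθ1 : θ < 1)
    {e : ℝ} (he : 0 < e) : ∃ δ > 0, ∀ d, 0 ≤ d → d ≤ δ → ∑' k : ℕ, β (d * θ ^ k) ≤ e := by
  have ht := tendsto_sum_nat_add (fun k : ℕ => β (1 * θ ^ k))
  obtain ⟨j, hj⟩ := (ht.eventually (gt_mem_nhds he)).exists
  refine ⟨θ ^ j, by positivity, fun d hd hdj => ?_⟩
  refine (h.dini_sum_mono hθ hθ1 hd hdj).trans (le_trans (le_of_eq ?_) hj.le)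
  exact tsum_congr fun k => by rw [one_mul, pow_add, mul_comm]

end LineSystem

/-- The maps `F i` acting simultaneously on both points of a pair. -/
def pairMap (F : Bool → ℝ → ℝ) (i : Bool) (z : ℝ × ℝ) : ℝ × ℝ := (F i z.1, F i z.2)

/-- The weights `q i` at the first point of a pair. -/
def pairWeight (q : Bool → ℝ → ℝ) (i : Bool) (z : ℝ × ℝ) : ℝ := q i z.1

theorem run_pairMap (F : Bool → ℝ → ℝ) (w : List Bool) (z : ℝ × ℝ) :
    run (pairMap F) w z = (run F w z.1, run F w z.2) := by
  induction w generalizing z with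
  | nil => rfl
  | cons i w ih => exact ih _

theorem mop_iterate_fst (F q : Bool → ℝ → ℝ) (ψ : ℝ → ℝ) (n : ℕ) :
    (mop (pairMap F) (pairWeight q))^[n] (fun z => ψ z.1) = fun z => (mop F q)^[n] ψ z.1 := by
  induction n with
  | zero => rfl
  | succ n ih =>
    rw [Function.iterate_succ_apply', ih, Function.iterate_succ_apply']
    rfl

theorem mop_average {ι X : Type*} [Fintype ι] (F : ι → X → X) (q : ι → X → ℝ) (ψ : X → ℝ)
    (N : ℕ) (x : X) :
    mop F q (fun x => (∑ k ∈ Finset.range N, (mop F q)^[k] ψ x) / N) x =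
      (∑ k ∈ Finset.range N, (mop F q)^[k] ψ x) / N + ((mop F q)^[N] ψ x - ψ x) / N := by
  have h1 : mop F q (fun x => (∑ k ∈ Finset.range N, (mop F q)^[k] ψ x) / N) x =
      (∑ k ∈ Finset.range N, (mop F q)^[k + 1] ψ x) / N := by
    simp only [mop, Function.iterate_succ_apply', Finset.sum_div, Finset.mul_sum]
    rw [Finset.sum_comm]
    exact Finset.sum_congr rfl fun k _ => Finset.sum_congr rfl fun i _ => by ring
  have h2 := Finset.sum_range_succ (fun k => (mop F q)^[k] ψ x) N
  rw [Finset.sum_range_succ'] at h2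
  rw [h1, ← add_div]
  congr 1
  simp only [Function.iterate_zero, id_eq] at h2
  linarith

namespace LineSystem

variable {F q : Bool → ℝ → ℝ} {V β : ℝ → ℝ} {ε l b : ℝ}

theorem isWeight_pairWeight (h : LineSystem F q V β ε l b) : IsWeight (pairWeight q) :=
  ⟨fun i z => h.weight.nonneg i z.1, fun z => h.weight.sum_one z.1⟩

/-- A function on pairs of points controlling the expected sum of the moduli `β` of the distances
along the pair of orbits. -/
theorem exists_supersolution (h : LineSystem F q V β ε l b) :
    ∃ r > 0, ∃ R : ℝ × ℝ → ℝ,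
      (∀ z, |z.1 - z.2| < r → 0 ≤ R z ∧
        mop (pairMap F) (pairWeight q) R z + β |z.1 - z.2| ≤ R z) ∧
      ∀ M, ∀ e > 0, ∃ δ > 0, ∀ z : ℝ × ℝ, V z.1 ≤ M → |z.1 - z.2| < δ → R z ≤ e := by
  have hl1 : 0 < 1 - l := by linarith [h.l_lt]
  obtain ⟨m, hm⟩ := h.V_proper ((b + 1) / (1 - l))
  obtain ⟨N, r, θ, hN, hr, hθ, hθ1, hw⟩ := h.exists_uniform_word m
  have hN' : (0 : ℝ) < N := Nat.cast_pos.2 hN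
  have hε := h.eps_pos
  have hb := h.b_nonneg
  set B : ℝ → ℝ := fun d => ∑' k : ℕ, β (d * θ ^ k) with hB
  set A : ℝ := N * (b + 1) / ε ^ N with hA
  have hA0 : 0 ≤ A := by positivity
  set T := mop (pairMap F) (pairWeight q) with hT
  have hq2 := h.isWeight_pairWeight
  set D : ℝ × ℝ → ℝ := fun z => B |z.1 - z.2| with hD
  set R₀ : ℝ × ℝ → ℝ := fun z => A * D z + N * β |z.1 - z.2| * V z.1 with hR₀
  have hS : ∀ d : ℝ, ∀ i, ∀ z ∈ {z : ℝ × ℝ | |z.1 - z.2| ≤ d},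
      pairMap F i z ∈ {z : ℝ × ℝ | |z.1 - z.2| ≤ d} :=
    fun d i z hz => (h.nonexp i z.1 z.2).trans hz
  have hβ : ∀ z : ℝ × ℝ, 0 ≤ β |z.1 - z.2| := fun z => h.beta_nonneg _ (abs_nonneg _)
  have hD0 : ∀ z, 0 ≤ D z := fun z => h.dini_sum_nonneg hθ (abs_nonneg _)
  have hR0 : ∀ z, 0 ≤ R₀ z := fun z => by
    have h1 := hβ z
    have h2 := h.V_nonneg z.1
    have h3 := hD0 z
    positivity
  have hTR0 : ∀ k z, 0 ≤ T^[k] R₀ z := fun k z => by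
    have := mop_iterate_mono_on (F := pairMap F) hq2 (S := univ) (fun _ _ _ => mem_univ _)
      (ψ := fun _ => 0) (ψ' := R₀) (fun z _ => hR0 z) k z (mem_univ _)
    rwa [mop_iterate_const hq2] at this
  have key : ∀ k z, T^[k] R₀ z ≤ A * T^[k] D z + N * β |z.1 - z.2| * (mop F q)^[k] V z.1 := by
    intro k z
    have h1 := mop_iterate_mono_on hq2 (hS |z.1 - z.2|) (ψ := R₀)
      (ψ' := fun y => A * D y + (N * β |z.1 - z.2|) * V y.1) (fun y hy => by
        have h2 := h.beta_mono _ _ (abs_nonneg _) hy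
        have h3 := h.V_nonneg y.1
        simp only [hR₀]
        gcongr) k z (le_refl |z.1 - z.2|)
    rw [mop_iterate_linear, mop_iterate_fst] at h1
    exact h1
  have hTD : ∀ k z, T^[k] D z ≤ D z := fun k z =>
    mop_iterate_le_const hq2 (hS |z.1 - z.2|)
      (fun y hy => h.dini_sum_mono hθ hθ1 (abs_nonneg _) hy) k (le_refl |z.1 - z.2|)
  have hUV : ∀ k u, (mop F q)^[k] V u ≤ l ^ k * V u + b :=
    mop_iterate_drift h.weight h.l_nonneg hb h.drift
  have hUV' : ∀ k u, (mop F q)^[k] V u ≤ V u + b := fun k u => by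
    have h1 := mul_le_mul_of_nonneg_right (pow_le_one₀ (n := k) h.l_nonneg h.l_lt.le)
      (h.V_nonneg u)
    linarith [hUV k u]
  have hTN : ∀ z, |z.1 - z.2| < r → T^[N] R₀ z ≤ R₀ z - N * β |z.1 - z.2| := by
    intro z hz
    have hNβ : 0 ≤ N * β |z.1 - z.2| := mul_nonneg hN'.le (hβ z)
    refine (key N z).trans ?_
    by_cases hVz : V z.1 ≤ (b + 1) / (1 - l)
    · obtain ⟨w, hwN, hwz⟩ := hw z.1 (hm _ hVz)
      have h1 : T^[N] D z ≤ D z - ε ^ N * β |z.1 - z.2| := by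
        rw [← hwN]
        refine mop_iterate_le_of_word hq2 hε.le (fun i z => h.eps_le i z.1) (hS |z.1 - z.2|)
          (hβ z) (fun y hy => h.dini_sum_mono hθ hθ1 (abs_nonneg _) hy) w z
          (le_refl |z.1 - z.2|) ?_
        rw [run_pairMap]
        have h2 := h.dini_sum_mono hθ hθ1 (abs_nonneg _) (hwz z.2 hz)
        have h3 := h.dini_sum_eq hθ hθ1 (abs_nonneg (z.1 - z.2))
        linarith
      have h2 := mul_le_mul_of_nonneg_left h1 hA0
      have h3 := mul_le_mul_of_nonneg_left (hUV' N z.1) hNβ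
      have h4 : A * (ε ^ N * β |z.1 - z.2|) = N * β |z.1 - z.2| * (b + 1) := by
        rw [hA]
        field_simp
      simp only [hR₀]
      nlinarith
    · rw [not_le, div_lt_iff₀ hl1] at hVz
      have h1 := mul_le_mul_of_nonneg_left (hTD N z) hA0
      have h2 : (mop F q)^[N] V z.1 ≤ V z.1 - 1 := by
        have h3 : l ^ N ≤ l := pow_le_of_le_one h.l_nonneg h.l_lt.le hN.ne'
        have h4 := mul_le_mul_of_nonneg_right h3 (h.V_nonneg z.1)
        linarith [hUV N z.1]
      have h3 := mul_le_mul_of_nonneg_left h2 hNβ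
      simp only [hR₀]
      linarith
  refine ⟨r, hr, fun z => (∑ k ∈ Finset.range N, T^[k] R₀ z) / N, fun z hz => ⟨?_, ?_⟩, ?_⟩
  · exact div_nonneg (Finset.sum_nonneg fun k _ => hTR0 k z) hN'.le
  · have h0 := mop_average (pairMap F) (pairWeight q) R₀ N z
    have h1 : ((mop (pairMap F) (pairWeight q))^[N] R₀ z - R₀ z) / N ≤ -β |z.1 - z.2| := by
      rw [div_le_iff₀ hN']
      linarith [hTN z hz]
    simp only [hT]
    rw [h0]
    linarith
  · intro M e he
    set C : ℝ := A + N * (|M| + b) + 1 with hC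
    have hC0 : 0 < C := by positivity
    obtain ⟨δ, hδ, hδB⟩ := h.exists_dini_sum_le hθ hθ1 (div_pos he hC0)
    refine ⟨δ, hδ, fun z hVz hz => ?_⟩
    rw [div_le_iff₀ hN']
    have hDe : D z ≤ e / C := hδB _ (abs_nonneg _) hz.le
    have hβD : β |z.1 - z.2| ≤ D z := by
      have h1 := h.dini_sum_eq hθ hθ1 (abs_nonneg (z.1 - z.2))
      have h2 := h.dini_sum_nonneg hθ (d := θ * |z.1 - z.2|) (by positivity)
      linarith
    have h1 : ∀ k ∈ Finset.range N, T^[k] R₀ z ≤ e := by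
      intro k _
      have h2 := mul_le_mul_of_nonneg_left (hTD k z) hA0
      have h3 : (mop F q)^[k] V z.1 ≤ |M| + b := (hUV' k z.1).trans (by
        linarith [le_abs_self M])
      have h4 : N * β |z.1 - z.2| * (mop F q)^[k] V z.1 ≤ N * D z * (|M| + b) := by
        have h5 := hβ z
        have h6 := hD0 z
        calc N * β |z.1 - z.2| * (mop F q)^[k] V z.1
            ≤ N * β |z.1 - z.2| * (|M| + b) := mul_le_mul_of_nonneg_left h3 (by positivity)
          _ ≤ N * D z * (|M| + b) := by gcongr
      have h5 : C * D z ≤ e := by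
        rw [le_div_iff₀ hC0] at hDe
        linarith
      have h6 := key k z
      have h7 := hD0 z
      rw [hC] at h5
      nlinarith
    have := Finset.sum_le_card_nsmul _ _ e h1
    rw [Finset.card_range, nsmul_eq_mul] at this
    linarith

end LineSystem

/-- The maps `F i`, `F j` acting independently on the two points of a pair. -/
def prodMap (F : Bool → ℝ → ℝ) (p : Bool × Bool) (z : ℝ × ℝ) : ℝ × ℝ := (F p.1 z.1, F p.2 z.2)

/-- The product weights of an independent pair. -/
def prodWeight (q : Bool → ℝ → ℝ) (p : Bool × Bool) (z : ℝ × ℝ) : ℝ := q p.1 z.1 * q p.2 z.2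

theorem run_prodMap (F : Bool → ℝ → ℝ) (w : List Bool) (z : ℝ × ℝ) :
    run (prodMap F) (w.map fun i => (i, i)) z = (run F w z.1, run F w z.2) := by
  induction w generalizing z with
  | nil => rfl
  | cons i w ih => exact ih _

theorem isWeight_prodWeight {q : Bool → ℝ → ℝ} (hq : IsWeight q) : IsWeight (prodWeight q) where
  nonneg p z := mul_nonneg (hq.nonneg _ _) (hq.nonneg _ _)
  sum_one z := by
    have h1 := hq.sum_one z.1
    have h2 := hq.sum_one z.2
    simp only [prodWeight, Fintype.sum_prod_type, Fintype.sum_bool] at h1 h2 ⊢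
    linear_combination (q true z.2 + q false z.2) * h1 + h2

theorem mop_prod_add {F q : Bool → ℝ → ℝ} (hq : IsWeight q) (ψ χ : ℝ → ℝ) (z : ℝ × ℝ) :
    mop (prodMap F) (prodWeight q) (fun z => ψ z.1 + χ z.2) z =
      mop F q ψ z.1 + mop F q χ z.2 := by
  have h1 := hq.sum_one z.1
  have h2 := hq.sum_one z.2
  simp only [mop, prodMap, prodWeight, Fintype.sum_prod_type, Fintype.sum_bool] at h1 h2 ⊢
  linear_combination (q true z.2 * χ (F true z.2) + q false z.2 * χ (F false z.2)) * h1 +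
    (q true z.1 * ψ (F true z.1) + q false z.1 * ψ (F false z.1)) * h2

theorem mop_iterate_prod_add {F q : Bool → ℝ → ℝ} (hq : IsWeight q) (ψ χ : ℝ → ℝ) (n : ℕ) :
    (mop (prodMap F) (prodWeight q))^[n] (fun z => ψ z.1 + χ z.2) =
      fun z => (mop F q)^[n] ψ z.1 + (mop F q)^[n] χ z.2 := by
  induction n with
  | zero => rfl
  | succ n ih =>
    rw [Function.iterate_succ_apply', ih]
    funext z
    rw [mop_prod_add hq, Function.iterate_succ_apply', Function.iterate_succ_apply']

theorem abs_mop_sub_le_prod {F q : Bool → ℝ → ℝ} (hq : IsWeight q) (ψ : ℝ → ℝ) (z : ℝ × ℝ) :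
    |mop F q ψ z.1 - mop F q ψ z.2| ≤
      mop (prodMap F) (prodWeight q) (fun z => |ψ z.1 - ψ z.2|) z := by
  have h := mop_prod_add (F := F) hq ψ (fun v => -ψ v) z
  have h1 : mop F q (fun v => -ψ v) z.2 = -mop F q ψ z.2 := by simp [mop]
  rw [h1, ← sub_eq_add_neg] at h
  rw [← h]
  refine (Finset.abs_sum_le_sum_abs _ _).trans (Finset.sum_le_sum fun p _ => ?_)
  rw [abs_mul, abs_of_nonneg ((isWeight_prodWeight hq).nonneg p z)]
  simp only [← sub_eq_add_neg]
  exact le_rfl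

namespace LineSystem

variable {F q : Bool → ℝ → ℝ} {V β : ℝ → ℝ} {ε l b : ℝ}

theorem abs_mop_iterate_le (h : LineSystem F q V β ε l b) {φ : ℝ → ℝ} {K : ℝ}
    (hK : ∀ u, |φ u| ≤ K) (n : ℕ) (u : ℝ) : |(mop F q)^[n] φ u| ≤ K := by
  induction n generalizing u with
  | zero => exact hK u
  | succ n ih =>
    rw [Function.iterate_succ_apply']
    refine (Finset.abs_sum_le_sum_abs _ _).trans ?_
    have h1 : ∑ i, |q i u * (mop F q)^[n] φ (F i u)| ≤ ∑ i, q i u * K := by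
      refine Finset.sum_le_sum fun i _ => ?_
      rw [abs_mul, abs_of_nonneg (h.weight.nonneg i u)]
      exact mul_le_mul_of_nonneg_left (ih _) (h.weight.nonneg i u)
    rwa [← Finset.sum_mul, h.weight.sum_one, one_mul] at h1

theorem abs_mop_sub_le_pair (h : LineSystem F q V β ε l b) {ψ : ℝ → ℝ} {K : ℝ}
    (hK : ∀ u, |ψ u| ≤ K) (z : ℝ × ℝ) :
    |mop F q ψ z.1 - mop F q ψ z.2| ≤
      mop (pairMap F) (pairWeight q) (fun z => |ψ z.1 - ψ z.2|) z + 2 * K * β |z.1 - z.2| := by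
  have h1 : mop F q ψ z.1 - mop F q ψ z.2 =
      ∑ i, (q i z.1 * (ψ (F i z.1) - ψ (F i z.2)) + (q i z.1 - q i z.2) * ψ (F i z.2)) := by
    simp only [mop, ← Finset.sum_sub_distrib]
    exact Finset.sum_congr rfl fun i _ => by ring
  have h2 : ∀ i, |q i z.1 * (ψ (F i z.1) - ψ (F i z.2)) + (q i z.1 - q i z.2) * ψ (F i z.2)| ≤
      q i z.1 * |ψ (F i z.1) - ψ (F i z.2)| + K * β |z.1 - z.2| := by
    intro i
    refine (abs_add_le _ _).trans ?_
    rw [abs_mul, abs_mul, abs_of_nonneg (h.weight.nonneg i z.1), mul_comm K]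
    gcongr
    · exact h.beta_nonneg _ (abs_nonneg _)
    · exact h.modulus i z.1 z.2
    · exact hK _
  rw [h1]
  refine (Finset.abs_sum_le_sum_abs _ _).trans ((Finset.sum_le_sum fun i _ => h2 i).trans ?_)
  rw [Finset.sum_add_distrib]
  simp only [mop, pairMap, pairWeight, Fintype.sum_bool]
  linarith

theorem eventually_V_pow_le (h : LineSystem F q V β ε l b) (a : ℝ) :
    ∀ᶠ n : ℕ in atTop, l ^ n * a ≤ 1 := by
  have ht : Tendsto (fun n : ℕ => l ^ n * a) atTop (𝓝 (0 * a)) :=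
    (tendsto_pow_atTop_nhds_zero_of_lt_one h.l_nonneg h.l_lt).mul_const _
  rw [zero_mul] at ht
  exact (ht.eventually (gt_mem_nhds one_pos)).mono fun _ hn => hn.le

theorem exists_uniform_modulus (h : LineSystem F q V β ε l b) {φ : ℝ → ℝ} (hφ : Continuous φ)
    (M : ℝ) {e : ℝ} (he : 0 < e) :
    ∃ δ > 0, ∀ u v, V u ≤ M → |u - v| < δ → |φ u - φ v| ≤ e := by
  obtain ⟨m, hm⟩ := h.V_proper M
  have h1 := (isCompact_Icc (a := -m) (b := m)).uniformContinuousAt_of_continuousAt φ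
    (fun u _ => hφ.continuousAt) (Metric.dist_mem_uniformity he)
  obtain ⟨δ, hδ, h2⟩ := Metric.mem_uniformity_dist.1 h1
  refine ⟨δ, hδ, fun u v hu huv => ?_⟩
  have h3 := h2 (a := u) (b := v) (by rwa [Real.dist_eq]) (abs_le.1 (hm u hu))
  have h4 : dist (φ u) (φ v) < e := h3
  rw [Real.dist_eq] at h4
  exact h4.le

theorem eventually_close (h : LineSystem F q V β ε l b) {φ : ℝ → ℝ} (hφ : Continuous φ) {K : ℝ}
    (hK : ∀ u, |φ u| ≤ K) (M : ℝ) {e : ℝ} (he : 0 < e) :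
    ∃ δ > 0, ∀ z : ℝ × ℝ, V z.1 ≤ M → |z.1 - z.2| < δ →
      ∀ᶠ n in atTop, |(mop F q)^[n] φ z.1 - (mop F q)^[n] φ z.2| ≤ e := by
  have hK0 : 0 ≤ K := (abs_nonneg _).trans (hK 0)
  have hb := h.b_nonneg
  obtain ⟨r, hr, R, hR, hRs⟩ := h.exists_supersolution
  set c : ℝ := e / (3 * (b + 1)) with hc
  have hc0 : 0 < c := by positivity
  obtain ⟨δ₁, hδ₁, hmod⟩ := h.exists_uniform_modulus hφ (2 * K / c) (show 0 < e / 3 by positivity)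
  obtain ⟨δ₂, hδ₂, hsmall⟩ := hRs M (e / (3 * (2 * K + 1))) (by positivity)
  have hS : ∀ i, ∀ z ∈ {z : ℝ × ℝ | |z.1 - z.2| < min r δ₁},
      pairMap F i z ∈ {z : ℝ × ℝ | |z.1 - z.2| < min r δ₁} :=
    fun i z hz => (h.nonexp i z.1 z.2).trans_lt hz
  have hq2 := h.isWeight_pairWeight
  have main : ∀ n : ℕ, ∀ z ∈ {z : ℝ × ℝ | |z.1 - z.2| < min r δ₁},
      |(mop F q)^[n] φ z.1 - (mop F q)^[n] φ z.2| ≤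
        e / 3 + c * (mop F q)^[n] V z.1 + 2 * K * R z := by
    intro n
    induction n with
    | zero =>
      intro z hz
      have h1 := (hR z (lt_of_lt_of_le hz (min_le_left _ _))).1
      have h2 : 0 ≤ 2 * K * R z := by positivity
      have h3 := h.V_nonneg z.1
      simp only [Function.iterate_zero, id_eq]
      by_cases hV : V z.1 ≤ 2 * K / c
      · have h4 := hmod z.1 z.2 hV (lt_of_lt_of_le hz (min_le_right _ _))
        have h5 : 0 ≤ c * V z.1 := by positivity
        linarith
      · rw [not_le, div_lt_iff₀ hc0] at hV
        have h4 := abs_sub (φ z.1) (φ z.2)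
        have h5 := hK z.1
        have h6 := hK z.2
        linarith
    | succ n ih =>
      intro z hz
      have h1 := (hR z (lt_of_lt_of_le hz (min_le_left _ _))).2
      have h2 := h.abs_mop_sub_le_pair (h.abs_mop_iterate_le hK n) z
      rw [Function.iterate_succ_apply', Function.iterate_succ_apply']
      refine h2.trans ?_
      have h3 : mop (pairMap F) (pairWeight q)
          (fun z => |(mop F q)^[n] φ z.1 - (mop F q)^[n] φ z.2|) z ≤
          e / 3 + c * mop F q ((mop F q)^[n] V) z.1 +
            2 * K * mop (pairMap F) (pairWeight q) R z := by
        refine (mop_iterate_mono_on hq2 hS ih 1 z hz).trans (le_of_eq ?_)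
        have h4 := hq2.sum_one z
        simp only [Function.iterate_one, mop, pairMap, Fintype.sum_bool] at h4 ⊢
        simp only [pairWeight] at h4 ⊢
        linear_combination (e / 3) * h4
      have h4 := mul_le_mul_of_nonneg_left h1 (show 0 ≤ 2 * K by positivity)
      linarith
  refine ⟨min (min r δ₁) δ₂, lt_min (lt_min hr hδ₁) hδ₂, fun z hz hzd => ?_⟩
  filter_upwards [h.eventually_V_pow_le (V z.1)] with n hn
  have h1 := main n z (lt_of_lt_of_le hzd (min_le_left _ _))
  have h2 := hsmall z hz (lt_of_lt_of_le hzd (min_le_right _ _))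
  have h3 := mop_iterate_drift h.weight h.l_nonneg hb h.drift n z.1
  have h4 : c * (mop F q)^[n] V z.1 ≤ e / 3 := by
    calc c * (mop F q)^[n] V z.1 ≤ c * (b + 1) := by gcongr; linarith
      _ = e / 3 := by rw [hc]; field_simp
  have h5 : 2 * K * R z ≤ e / 3 := by
    have h6 : (2 * K + 1) * (e / (3 * (2 * K + 1))) = e / 3 := by field_simp
    have h7 : 0 ≤ e / (3 * (2 * K + 1)) := by positivity
    have h8 := mul_le_mul_of_nonneg_left h2 (show 0 ≤ 2 * K by positivity)
    linarith
  linarith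

theorem eventually_le_mop_prod (h : LineSystem F q V β ε l b) {φ : ℝ → ℝ} {C : ℝ × ℝ → ℝ}
    (hC : ∀ z : ℝ × ℝ, ∀ᶠ n in atTop, |(mop F q)^[n] φ z.1 - (mop F q)^[n] φ z.2| ≤ C z)
    (k : ℕ) (z : ℝ × ℝ) :
    ∀ᶠ n in atTop, |(mop F q)^[n] φ z.1 - (mop F q)^[n] φ z.2| ≤
      (mop (prodMap F) (prodWeight q))^[k] C z := by
  induction k generalizing z with
  | zero => exact hC z
  | succ k ih =>
    have h1 : ∀ᶠ n in atTop, ∀ p : Bool × Bool,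
        |(mop F q)^[n] φ (prodMap F p z).1 - (mop F q)^[n] φ (prodMap F p z).2| ≤
          (mop (prodMap F) (prodWeight q))^[k] C (prodMap F p z) :=
      eventually_all.2 fun p => ih _
    rw [eventually_atTop] at h1 ⊢
    obtain ⟨n₀, hn₀⟩ := h1
    refine ⟨n₀ + 1, fun n hn => ?_⟩
    obtain ⟨n, rfl⟩ : ∃ n', n = n' + 1 := ⟨n - 1, by omega⟩
    rw [Function.iterate_succ_apply', Function.iterate_succ_apply']
    refine (abs_mop_sub_le_prod h.weight _ z).trans (Finset.sum_le_sum fun p _ => ?_)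
    exact mul_le_mul_of_nonneg_left (hn₀ n (by omega) p)
      ((isWeight_prodWeight h.weight).nonneg p z)

theorem exists_gain_on_sublevel (h : LineSystem F q V β ε l b) {φ : ℝ → ℝ} (hφ : Continuous φ)
    {K : ℝ} (hK : ∀ u, |φ u| ≤ K) (M : ℝ) {e : ℝ} (he : 0 < e) :
    ∃ κ : ℝ, 0 < κ ∧ κ ≤ 1 ∧ ∀ c, e ≤ c →
      (∀ z : ℝ × ℝ, ∀ᶠ n in atTop, |(mop F q)^[n] φ z.1 - (mop F q)^[n] φ z.2| ≤ c) →
      ∀ z : ℝ × ℝ, V z.1 ≤ M → V z.2 ≤ M →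
        ∀ᶠ n in atTop, |(mop F q)^[n] φ z.1 - (mop F q)^[n] φ z.2| ≤ c - κ * (c - e) := by
  obtain ⟨m, hm⟩ := h.V_proper M
  obtain ⟨m₁, hm₁⟩ := h.V_proper (b + 1)
  obtain ⟨M₁, hM₁⟩ := h.V_bdd (m₁ + 1)
  obtain ⟨δ, hδ, hclose⟩ := h.eventually_close hφ hK M₁ he
  set O : List Bool → Set (ℝ × ℝ) :=
    fun w => {z | |run F w z.1 - run F w z.2| < δ ∧ |run F w z.1| < m₁ + 1} with hO
  have hOo : ∀ w, IsOpen (O w) := fun w => by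
    have := h.continuous_run w
    have h1 : IsOpen {z : ℝ × ℝ | |run F w z.1 - run F w z.2| < δ} :=
      isOpen_lt (by fun_prop) continuous_const
    have h2 : IsOpen {z : ℝ × ℝ | |run F w z.1| < m₁ + 1} :=
      isOpen_lt (by fun_prop) continuous_const
    exact h1.inter h2
  obtain ⟨t, ht⟩ := ((isCompact_Icc (a := -m) (b := m)).prod
    (isCompact_Icc (a := -m) (b := m))).elim_finite_subcover O hOo (fun z _ => by
      obtain ⟨w, hw, hwV⟩ := h.exists_run_close z.1 z.2 hδ
      exact mem_iUnion.2 ⟨w, hw, (hm₁ _ hwV).trans_lt (lt_add_one _)⟩)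
  have hε := h.eps_pos
  have hε1 : ε ≤ 1 := by
    have h1 := h.weight.sum_one 0
    rw [Fintype.sum_bool] at h1
    linarith [h.eps_le true 0, h.weight.nonneg false 0]
  have hεε : ε * ε ≤ 1 := mul_le_one₀ hε1 hε.le hε1
  set L := t.sup List.length with hL
  refine ⟨(ε * ε) ^ L, by positivity, pow_le_one₀ (by positivity) hεε, ?_⟩
  intro c hec hc z hz1 hz2
  obtain ⟨w, hwt, hw⟩ := mem_iUnion₂.1 (ht ⟨abs_le.1 (hm _ hz1), abs_le.1 (hm _ hz2)⟩)
  classical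
  have h1 := h.eventually_le_mop_prod (φ := φ)
    (C := fun z => if V z.1 ≤ M₁ ∧ |z.1 - z.2| < δ then e else c) (fun z => by
      by_cases hzz : V z.1 ≤ M₁ ∧ |z.1 - z.2| < δ
      · rw [if_pos hzz]
        exact hclose z hzz.1 hzz.2
      · rw [if_neg hzz]
        exact hc z) w.length z
  refine h1.mono fun n hn => hn.trans ?_
  have h2 := mop_iterate_le_of_word (F := prodMap F) (isWeight_prodWeight h.weight)
    (ε := ε * ε) (by positivity)
    (fun p z => mul_le_mul (h.eps_le p.1 z.1) (h.eps_le p.2 z.2) hε.le (h.weight.nonneg _ _))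
    (S := univ) (fun _ _ _ => mem_univ _)
    (ψ := fun z => if V z.1 ≤ M₁ ∧ |z.1 - z.2| < δ then e else c) (c := c) (s := c - e)
    (by linarith) (fun z _ => by split_ifs <;> linarith) (w.map fun i => (i, i)) z (mem_univ z)
    (by
      rw [run_prodMap, if_pos ⟨hM₁ _ hw.2.le, hw.1⟩]
      linarith)
  rw [List.length_map] at h2
  refine h2.trans ?_
  have h3 : (ε * ε) ^ L ≤ (ε * ε) ^ w.length :=
    pow_le_pow_of_le_one (by positivity) hεε (Finset.le_sup (f := List.length) hwt)
  have h4 := mul_le_mul_of_nonneg_right h3 (show 0 ≤ c - e by linarith)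
  linarith

theorem exists_gain (h : LineSystem F q V β ε l b) {φ : ℝ → ℝ} (hφ : Continuous φ)
    {K : ℝ} (hK : ∀ u, |φ u| ≤ K) {e : ℝ} (he : 0 < e) :
    ∃ κ : ℝ, 0 < κ ∧ κ ≤ 1 ∧ ∀ c, e ≤ c →
      (∀ z : ℝ × ℝ, ∀ᶠ n in atTop, |(mop F q)^[n] φ z.1 - (mop F q)^[n] φ z.2| ≤ c) →
      ∀ z : ℝ × ℝ,
        ∀ᶠ n in atTop, |(mop F q)^[n] φ z.1 - (mop F q)^[n] φ z.2| ≤ c - κ * (c - e) := by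
  have hb := h.b_nonneg
  set M : ℝ := 4 * b + 4 with hM
  have hM0 : 0 < M := by positivity
  obtain ⟨κ, hκ, hκ1, hgain⟩ := h.exists_gain_on_sublevel hφ hK M he
  refine ⟨κ / 2, by positivity, by linarith, fun c hec hc z => ?_⟩
  have hsub := hgain c hec hc
  set s : ℝ := κ * (c - e) with hs
  have hs0 : 0 ≤ s := mul_nonneg hκ.le (by linarith)
  have h1 := h.eventually_le_mop_prod (φ := φ)
    (C := fun z => (c - s) * (fun _ => 1 : ℝ × ℝ → ℝ) z +
      s / M * (fun z : ℝ × ℝ => V z.1 + V z.2) z) (fun z => by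
      have hV1 := h.V_nonneg z.1
      have hV2 := h.V_nonneg z.2
      by_cases hz : V z.1 ≤ M ∧ V z.2 ≤ M
      · refine (hsub z hz.1 hz.2).mono fun n hn => hn.trans ?_
        have : 0 ≤ s / M * (V z.1 + V z.2) := by positivity
        simp only
        linarith
      · refine (hc z).mono fun n hn => hn.trans ?_
        have h2 : M ≤ V z.1 + V z.2 := by
          by_contra hcon
          exact hz ⟨by linarith, by linarith⟩
        have h3 := mul_le_mul_of_nonneg_left h2 (show 0 ≤ s / M by positivity)
        rw [div_mul_cancel₀ _ hM0.ne'] at h3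
        simp only
        linarith)
  obtain ⟨k, hk⟩ := (h.eventually_V_pow_le (V z.1 + V z.2)).exists
  refine (h1 k z).mono fun n hn => hn.trans ?_
  rw [mop_iterate_linear, mop_iterate_const (isWeight_prodWeight h.weight),
    mop_iterate_prod_add h.weight]
  have h2 := mop_iterate_drift h.weight h.l_nonneg hb h.drift k z.1
  have h3 := mop_iterate_drift h.weight h.l_nonneg hb h.drift k z.2
  have h4 : (mop F q)^[k] V z.1 + (mop F q)^[k] V z.2 ≤ M / 2 := by rw [hM]; linarith
  have h5 := mul_le_mul_of_nonneg_left h4 (show 0 ≤ s / M by positivity)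
  have h6 : s / M * (M / 2) = s / 2 := by field_simp
  have h7 : κ / 2 * (c - e) = s / 2 := by rw [hs]; ring
  rw [h7]
  simp only
  linarith

theorem tendsto_mop_iterate_sub (h : LineSystem F q V β ε l b) {φ : ℝ → ℝ} (hφ : Continuous φ)
    {K : ℝ} (hK : ∀ u, |φ u| ≤ K) (u v : ℝ) :
    Tendsto (fun n => (mop F q)^[n] φ u - (mop F q)^[n] φ v) atTop (𝓝 0) := by
  have hK0 : 0 ≤ K := (abs_nonneg _).trans (hK 0)
  rw [Metric.tendsto_nhds]
  intro e he
  obtain ⟨κ, hκ, hκ1, hgain⟩ := h.exists_gain hφ hK (half_pos he)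
  have main : ∀ j : ℕ, ∀ z : ℝ × ℝ, ∀ᶠ n in atTop,
      |(mop F q)^[n] φ z.1 - (mop F q)^[n] φ z.2| ≤ e / 2 + (1 - κ) ^ j * (2 * K) := by
    intro j
    induction j with
    | zero =>
      refine fun z => Eventually.of_forall fun n => ?_
      have h1 := h.abs_mop_iterate_le hK n z.1
      have h2 := h.abs_mop_iterate_le hK n z.2
      have h3 := abs_sub ((mop F q)^[n] φ z.1) ((mop F q)^[n] φ z.2)
      rw [pow_zero]
      linarith
    | succ j ih =>
      have h0 : 0 ≤ (1 - κ) ^ j * (2 * K) :=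
        mul_nonneg (pow_nonneg (by linarith) _) (by positivity)
      intro z
      refine (hgain _ (by linarith) ih z).mono fun n hn => hn.trans (le_of_eq ?_)
      ring
  have ht : Tendsto (fun j : ℕ => (1 - κ) ^ j * (2 * K)) atTop (𝓝 (0 * (2 * K))) :=
    (tendsto_pow_atTop_nhds_zero_of_lt_one (by linarith) (by linarith)).mul_const _
  rw [zero_mul] at ht
  obtain ⟨j, hj⟩ := (ht.eventually (gt_mem_nhds (half_pos he))).exists
  filter_upwards [main j (u, v)] with n hn
  rw [Real.dist_eq, sub_zero]
  exact hn.trans_lt (by linarith)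

end LineSystem

/-- The logarithmic coordinate identifying `(0,1)` with the line. -/
noncomputable def toLine (x : ℝ) : ℝ :=
  if x ≤ 1 / 2 then Real.log (2 * x) else -Real.log (2 * (1 - x))

/-- The inverse of `toLine`. -/
noncomputable def ofLine (u : ℝ) : ℝ :=
  if u ≤ 0 then Real.exp u / 2 else 1 - Real.exp (-u) / 2

theorem toLine_of_le {x : ℝ} (hx : x ≤ 1 / 2) : toLine x = Real.log (2 * x) := if_pos hx

theorem toLine_of_ge {x : ℝ} (hx : 1 / 2 ≤ x) : toLine x = -Real.log (2 * (1 - x)) := by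
  rcases hx.eq_or_lt with rfl | hx
  · rw [toLine_of_le le_rfl]
    norm_num
  · exact if_neg (not_le.2 hx)

theorem ofLine_of_nonpos {u : ℝ} (hu : u ≤ 0) : ofLine u = Real.exp u / 2 := if_pos hu

theorem ofLine_of_nonneg {u : ℝ} (hu : 0 ≤ u) : ofLine u = 1 - Real.exp (-u) / 2 := by
  rcases hu.eq_or_lt with rfl | hu
  · rw [ofLine_of_nonpos le_rfl]
    norm_num
  · exact if_neg (not_le.2 hu)

theorem toLine_one_sub (x : ℝ) : toLine (1 - x) = -toLine x := by
  rcases le_total x (1 / 2) with hx | hx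
  · rw [toLine_of_le hx, toLine_of_ge (by linarith), sub_sub_cancel]
  · rw [toLine_of_ge hx, toLine_of_le (by linarith), neg_neg]

theorem ofLine_neg (u : ℝ) : ofLine (-u) = 1 - ofLine u := by
  rcases le_total u 0 with hu | hu
  · rw [ofLine_of_nonpos hu, ofLine_of_nonneg (by linarith), neg_neg]
  · rw [ofLine_of_nonneg hu, ofLine_of_nonpos (by linarith), sub_sub_cancel]

theorem ofLine_le_half {u : ℝ} (hu : u ≤ 0) : ofLine u ≤ 1 / 2 := by
  rw [ofLine_of_nonpos hu]
  have := Real.exp_le_one_iff.2 hu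
  linarith

theorem half_le_ofLine {u : ℝ} (hu : 0 ≤ u) : 1 / 2 ≤ ofLine u := by
  have := ofLine_le_half (u := -u) (by linarith)
  rw [ofLine_neg] at this
  linarith

theorem ofLine_mem (u : ℝ) : ofLine u ∈ Ioo (0 : ℝ) 1 := by
  have key : ∀ v ≤ 0, ofLine v ∈ Ioo (0 : ℝ) 1 := fun v hv =>
    ⟨by rw [ofLine_of_nonpos hv]; positivity, by linarith [ofLine_le_half hv]⟩
  rcases le_total u 0 with hu | hu
  · exact key u hu
  · have h := key (-u) (by linarith)
    rw [ofLine_neg] at h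
    exact ⟨by linarith [h.2], by linarith [h.1]⟩

theorem toLine_ofLine (u : ℝ) : toLine (ofLine u) = u := by
  rcases le_total u 0 with hu | hu
  · rw [toLine_of_le (ofLine_le_half hu), ofLine_of_nonpos hu, mul_div_cancel₀ _ two_ne_zero,
      Real.log_exp]
  · rw [toLine_of_ge (half_le_ofLine hu), ofLine_of_nonneg hu, sub_sub_cancel,
      mul_div_cancel₀ _ two_ne_zero, Real.log_exp, neg_neg]

theorem ofLine_toLine {x : ℝ} (hx : x ∈ Ioo (0 : ℝ) 1) : ofLine (toLine x) = x := by
  have key : ∀ y : ℝ, 0 < y → y ≤ 1 / 2 → ofLine (toLine y) = y := fun y hy hy2 => by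
    rw [toLine_of_le hy2, ofLine_of_nonpos (Real.log_nonpos (by linarith) (by linarith)),
      Real.exp_log (by linarith), mul_div_cancel_left₀ _ two_ne_zero]
  rcases le_total x (1 / 2) with h | h
  · exact key x hx.1 h
  · have h1 := key (1 - x) (by linarith [hx.2]) (by linarith)
    rw [toLine_one_sub, ofLine_neg] at h1
    linarith

theorem monotone_ofLine : Monotone ofLine := by
  refine MonotoneOn.Iic_union_Ici (a := 0) (fun u hu v hv huv => ?_) fun u hu v hv huv => ?_
  · rw [ofLine_of_nonpos hu, ofLine_of_nonpos hv]
    gcongr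
  · rw [ofLine_of_nonneg hu, ofLine_of_nonneg hv]
    gcongr

theorem exp_sub_exp_le {u v : ℝ} (huv : u ≤ v) (hv : v ≤ 0) :
    Real.exp v - Real.exp u ≤ v - u := by
  have h1 := Real.add_one_le_exp (u - v)
  have h2 : Real.exp u = Real.exp v * Real.exp (u - v) := by rw [← Real.exp_add]; ring_nf
  have h3 := Real.exp_le_one_iff.2 hv
  have h4 := mul_le_mul_of_nonneg_left h1 (Real.exp_pos v).le
  nlinarith

theorem monotone_sub_ofLine : Monotone fun u => u - ofLine u := by
  refine MonotoneOn.Iic_union_Ici (a := 0) (fun u hu v hv huv => ?_) fun u hu v hv huv => ?_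
  · simp only [ofLine_of_nonpos hu, ofLine_of_nonpos hv]
    have := exp_sub_exp_le huv hv
    linarith
  · simp only [ofLine_of_nonneg hu, ofLine_of_nonneg hv]
    have := exp_sub_exp_le (neg_le_neg huv) (neg_nonpos.2 hu)
    linarith

theorem abs_sub_le_of_monotone {f : ℝ → ℝ} (h1 : Monotone f) (h2 : Monotone fun u => u - f u)
    (u v : ℝ) : |f u - f v| ≤ |u - v| := by
  rcases le_total u v with h | h
  · have h3 := h1 h
    have h4 := h2 h
    simp only at h4
    rw [abs_of_nonpos (by linarith), abs_of_nonpos (by linarith)]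
    linarith
  · have h3 := h1 h
    have h4 := h2 h
    simp only at h4
    rw [abs_of_nonneg (by linarith), abs_of_nonneg (by linarith)]
    linarith

theorem abs_ofLine_sub_le (u v : ℝ) : |ofLine u - ofLine v| ≤ |u - v| :=
  abs_sub_le_of_monotone monotone_ofLine monotone_sub_ofLine u v

theorem continuous_ofLine : Continuous ofLine := by
  refine (LipschitzWith.of_dist_le_mul (K := 1) fun u v => ?_).continuous
  simpa [Real.dist_eq] using abs_ofLine_sub_le u v

theorem tendsto_ofLine_atTop : Tendsto ofLine atTop (𝓝 1) := by
  have h : Tendsto (fun u : ℝ => 1 - Real.exp (-u) / 2) atTop (𝓝 (1 - 0 / 2)) :=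
    (Real.tendsto_exp_neg_atTop_nhds_zero.div_const 2).const_sub 1
  rw [zero_div, sub_zero] at h
  refine h.congr' ?_
  filter_upwards [eventually_ge_atTop 0] with u hu
  exact (ofLine_of_nonneg hu).symm

theorem tendsto_ofLine_atBot : Tendsto ofLine atBot (𝓝 0) := by
  have h : Tendsto (fun u : ℝ => Real.exp u / 2) atBot (𝓝 (0 / 2)) :=
    Real.tendsto_exp_atBot.div_const 2
  rw [zero_div] at h
  refine h.congr' ?_
  filter_upwards [eventually_le_atBot 0] with u hu
  exact (ofLine_of_nonpos hu).symm

theorem monotoneOn_toLine : MonotoneOn toLine (Ioo 0 1) := by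
  intro x hx y hy hxy
  by_contra h
  have h1 := monotone_ofLine (not_le.1 h).le
  rw [ofLine_toLine hx, ofLine_toLine hy] at h1
  rw [le_antisymm hxy h1] at h
  exact h le_rfl

theorem log_affine_le {a x y κ : ℝ} (ha0 : 0 < a) (ha1 : a < 1) (hxy : x ≤ y) (hy : y < 1)
    (hκ : a * (1 - x) ≤ κ * (1 - a * x)) :
    Real.log (1 - a * x) - Real.log (1 - a * y) ≤
      κ * (Real.log (1 - x) - Real.log (1 - y)) := by
  have hx1 : 0 < 1 - x := by linarith
  have hy1 : 0 < 1 - y := by linarith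
  have hax : 0 < 1 - a * x := by nlinarith
  have hay : 0 < 1 - a * y := by nlinarith
  set c : ℝ := a * (1 - x) / (1 - a * x) with hc
  have hc0 : 0 ≤ c := by positivity
  have hc1 : c ≤ 1 := by rw [hc, div_le_one hax]; linarith
  have hcκ : c ≤ κ := by rwa [hc, div_le_iff₀ hax]
  have h1 := strictConcaveOn_log_Ioi.concaveOn.2 (x := (1 - y) / (1 - x)) (y := 1)
    (div_pos hy1 hx1) (mem_Ioi.2 one_pos) hc0 (sub_nonneg.2 hc1) (by ring)
  simp only [smul_eq_mul, Real.log_one, mul_zero, add_zero, mul_one] at h1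
  have h2 : c * ((1 - y) / (1 - x)) + (1 - c) = (1 - a * y) / (1 - a * x) := by
    rw [hc]
    field_simp
    ring
  rw [h2, Real.log_div hy1.ne' hx1.ne', Real.log_div hay.ne' hax.ne'] at h1
  have h3 : Real.log (1 - y) ≤ Real.log (1 - x) := Real.log_le_log hy1 (by linarith)
  have h4 := mul_le_mul_of_nonneg_right hcκ (sub_nonneg.2 h3)
  linarith

theorem log_sub_log_le {x y κ : ℝ} (hx : 0 < x) (hxy : x ≤ y) (hy : y < 1)
    (hκ : 1 - x ≤ κ * x) :
    Real.log y - Real.log x ≤ κ * (Real.log (1 - x) - Real.log (1 - y)) := by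
  have hx1 : 0 < 1 - x := by linarith
  have hy1 : 0 < 1 - y := by linarith
  have h1 := Real.log_le_sub_one_of_pos (div_pos (hx.trans_le hxy) hx)
  have h2 := Real.log_le_sub_one_of_pos (div_pos hy1 hx1)
  rw [Real.log_div (by linarith) hx.ne'] at h1
  rw [Real.log_div hy1.ne' hx1.ne'] at h2
  have hκ0 : 0 ≤ κ := by
    by_contra h
    nlinarith
  have h3 := mul_le_mul_of_nonneg_left h2 hκ0
  have h4 : y / x - 1 ≤ κ * (1 - (1 - y) / (1 - x)) := by
    have e1 : y / x - 1 = (1 - x) * ((y - x) / (x * (1 - x))) := by field_simp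
    have e2 : κ * (1 - (1 - y) / (1 - x)) = κ * x * ((y - x) / (x * (1 - x))) := by
      field_simp
      ring
    rw [e1, e2]
    exact mul_le_mul_of_nonneg_right hκ (div_nonneg (by linarith) (by positivity))
  linarith

theorem toLine_mul_sub_le {a ξ x y κ : ℝ} (ha0 : 0 < a) (ha1 : a < 1) (hξ : 1 / 2 ≤ ξ)
    (hξx : ξ ≤ x) (hxy : x ≤ y) (hy : y < 1) (hκ1 : κ ≤ 1) (h1 : 1 - ξ ≤ κ * ξ)
    (h2 : a * (1 - ξ) ≤ κ * (1 - a * ξ)) :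
    toLine (a * y) - toLine (a * x) ≤ κ * (toLine y - toLine x) := by
  have hκ0 : 0 ≤ κ := by
    by_contra h
    nlinarith
  have c1 : ∀ z, ξ ≤ z → 1 - z ≤ κ * z := fun z hz => by nlinarith
  have c2 : ∀ z, ξ ≤ z → a * (1 - z) ≤ κ * (1 - a * z) := fun z hz => by
    have := mul_nonneg (mul_nonneg ha0.le (sub_nonneg.2 hz)) (sub_nonneg.2 hκ1)
    linarith
  have hlog : ∀ z, 1 / 2 ≤ z → z < 1 → toLine z = -(Real.log 2 + Real.log (1 - z)) := by
    intro z hz hz1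
    rw [toLine_of_ge hz, Real.log_mul two_ne_zero (by linarith)]
  have low : ∀ x y, ξ ≤ x → x ≤ y → y < 1 → a * y ≤ 1 / 2 →
      toLine (a * y) - toLine (a * x) ≤ κ * (toLine y - toLine x) := by
    intro x y hξx hxy hy hay
    have hx0 : 0 < x := by linarith
    have hy0 : 0 < y := by linarith
    have hax : a * x ≤ a * y := mul_le_mul_of_nonneg_left hxy ha0.le
    rw [toLine_of_le hay, toLine_of_le (hax.trans hay), hlog x (by linarith) (by linarith),
      hlog y (by linarith) hy, Real.log_mul two_ne_zero (by positivity),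
      Real.log_mul two_ne_zero (by positivity), Real.log_mul ha0.ne' hx0.ne',
      Real.log_mul ha0.ne' hy0.ne']
    have := log_sub_log_le hx0 hxy hy (c1 x hξx)
    linarith
  have high : ∀ x y, ξ ≤ x → x ≤ y → y < 1 → 1 / 2 ≤ a * x →
      toLine (a * y) - toLine (a * x) ≤ κ * (toLine y - toLine x) := by
    intro x y hξx hxy hy hax
    have hay : a * x ≤ a * y := mul_le_mul_of_nonneg_left hxy ha0.le
    have := log_affine_le ha0 ha1 hxy hy (c2 x hξx)
    rw [hlog x (by linarith) (by linarith), hlog y (by linarith) hy,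
      hlog (a * x) hax (by nlinarith), hlog (a * y) (hax.trans hay) (by nlinarith)]
    linarith
  rcases le_total (a * y) (1 / 2) with h | h
  · exact low x y hξx hxy hy h
  rcases le_total (1 / 2) (a * x) with h' | h'
  · exact high x y hξx hxy hy h'
  set z : ℝ := 1 / 2 / a with hz
  have hza : a * z = 1 / 2 := by rw [hz]; field_simp
  have hxz : x ≤ z := by rw [hz, le_div_iff₀ ha0]; linarith
  have hzy : z ≤ y := by rw [hz, div_le_iff₀ ha0]; linarith
  have e1 := low x z hξx hxz (hzy.trans_lt hy) hza.le
  have e2 := high z y (hξx.trans hxz) hzy hy hza.ge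
  linarith

/-- The maps of the system in the logarithmic coordinate. -/
noncomputable def liftMap (x₀ y₀ : ℝ) (i : Bool) (u : ℝ) : ℝ :=
  toLine (AM.fb x₀ y₀ i (ofLine u))

section LiftMap

variable {x₀ y₀ : ℝ}

theorem ratio_mem (h : AM.A1 x₀ y₀) : y₀ / x₀ ∈ Ioo (0 : ℝ) 1 := by
  obtain ⟨h1, h2, h3, h4⟩ := h
  have : 0 < x₀ := by linarith
  exact ⟨div_pos (by linarith) this, (div_lt_one this).2 h4⟩

theorem one_lt_ratio (h : AM.A1 x₀ y₀) : 1 < (1 - y₀) / (1 - x₀) := by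
  obtain ⟨h1, h2, h3, h4⟩ := h
  rw [lt_div_iff₀ (by linarith)]
  linarith

theorem f0_of_le {x : ℝ} (hx : x ≤ x₀) : AM.f0 x₀ y₀ x = y₀ / x₀ * x := if_pos hx

theorem f0_of_ge (h : AM.A1 x₀ y₀) {x : ℝ} (hx : x₀ ≤ x) :
    AM.f0 x₀ y₀ x = (1 - y₀) / (1 - x₀) * (x - 1) + 1 := by
  obtain ⟨h1, h2, h3, h4⟩ := h
  rcases hx.eq_or_lt with rfl | hx
  · rw [f0_of_le le_rfl]
    have h5 : x₀ ≠ 0 := by linarith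
    have h6 : 1 - x₀ ≠ 0 := by linarith
    field_simp
    ring
  · exact if_neg (not_le.2 hx)

theorem f0_mem (h : AM.A1 x₀ y₀) {x : ℝ} (hx : x ∈ Ioo (0 : ℝ) 1) :
    AM.f0 x₀ y₀ x ∈ Ioo (0 : ℝ) 1 := by
  have ha := ratio_mem h
  have hb := one_lt_ratio h
  rcases le_total x x₀ with hx0 | hx0
  · rw [f0_of_le hx0]
    exact ⟨mul_pos ha.1 hx.1, by nlinarith [ha.1, ha.2, hx.1, hx.2]⟩
  · rw [f0_of_ge h hx0]
    obtain ⟨h1, h2, h3, h4⟩ := h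
    have h5 : (1 - y₀) / (1 - x₀) * (1 - x) ≤ 1 - y₀ := by
      rw [div_mul_eq_mul_div, div_le_iff₀ (by linarith)]
      exact mul_le_mul_of_nonneg_left (by linarith) (by linarith)
    constructor
    · linarith
    · nlinarith [hx.2]

theorem fb_true (x : ℝ) : AM.fb x₀ y₀ true x = 1 - AM.fb x₀ y₀ false (1 - x) := rfl

theorem fb_mem (h : AM.A1 x₀ y₀) (i : Bool) {x : ℝ} (hx : x ∈ Ioo (0 : ℝ) 1) :
    AM.fb x₀ y₀ i x ∈ Ioo (0 : ℝ) 1 := by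
  cases i
  · exact f0_mem h hx
  · have h1 := f0_mem h (x := 1 - x) ⟨by linarith [hx.2], by linarith [hx.1]⟩
    rw [fb_true]
    exact ⟨by linarith [h1.2, show AM.fb x₀ y₀ false (1 - x) = AM.f0 x₀ y₀ (1 - x) from rfl],
      by linarith [h1.1, show AM.fb x₀ y₀ false (1 - x) = AM.f0 x₀ y₀ (1 - x) from rfl]⟩

theorem continuous_fb (h : AM.A1 x₀ y₀) (i : Bool) : Continuous (AM.fb x₀ y₀ i) := by
  have h0 : Continuous (AM.f0 x₀ y₀) := by
    refine Continuous.if_le (by fun_prop) (by fun_prop) continuous_id continuous_const ?_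
    rintro x rfl
    rw [← f0_of_ge h le_rfl, f0_of_le le_rfl]
  cases i
  · exact h0
  · exact continuous_const.sub (h0.comp (continuous_const.sub continuous_id))

theorem liftMap_not (i : Bool) (u : ℝ) : liftMap x₀ y₀ (!i) u = -liftMap x₀ y₀ i (-u) := by
  cases i
  · rw [Bool.not_false, liftMap, liftMap, fb_true, toLine_one_sub, ofLine_neg]
  · rw [Bool.not_true, liftMap, liftMap, fb_true, toLine_one_sub, ofLine_neg, sub_sub_cancel,
      neg_neg]

theorem run_liftMap_not (w : List Bool) (u : ℝ) :
    run (liftMap x₀ y₀) (w.map not) u = -run (liftMap x₀ y₀) w (-u) := by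
  induction w generalizing u with
  | nil => exact (neg_neg u).symm
  | cons i w ih =>
    simp only [List.map_cons, run]
    rw [ih, liftMap_not, neg_neg]

/-- The point of the line beyond which both maps are translations. -/
noncomputable def breakPoint (x₀ : ℝ) : ℝ := -Real.log (2 * (1 - x₀))

theorem ofLine_breakPoint (h : AM.A1 x₀ y₀) : ofLine (breakPoint x₀) = x₀ := by
  obtain ⟨h1, h2, -⟩ := h
  rw [breakPoint, ← toLine_of_ge h1.le, ofLine_toLine ⟨by linarith, h2⟩]

theorem breakPoint_pos (h : AM.A1 x₀ y₀) : 0 < breakPoint x₀ := by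
  obtain ⟨h1, h2, -⟩ := h
  have := Real.log_neg (x := 2 * (1 - x₀)) (by linarith) (by linarith)
  rw [breakPoint]
  linarith

theorem liftMap_false_of_nonpos (h : AM.A1 x₀ y₀) {u : ℝ} (hu : u ≤ 0) :
    liftMap x₀ y₀ false u = u + Real.log (y₀ / x₀) := by
  have ha := ratio_mem h
  have h1 := ofLine_le_half hu
  have h2 := (ofLine_mem u).1
  have h3 : AM.fb x₀ y₀ false (ofLine u) = y₀ / x₀ * ofLine u := f0_of_le (by linarith [h.1])
  rw [liftMap, h3, toLine_of_le (by nlinarith [ha.2]), ofLine_of_nonpos hu,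
    show 2 * (y₀ / x₀ * (Real.exp u / 2)) = y₀ / x₀ * Real.exp u by ring,
    Real.log_mul ha.1.ne' (Real.exp_pos u).ne', Real.log_exp]
  ring

theorem liftMap_false_of_ge (h : AM.A1 x₀ y₀) {u : ℝ} (hu : breakPoint x₀ ≤ u) :
    liftMap x₀ y₀ false u = u - Real.log ((1 - y₀) / (1 - x₀)) := by
  have hb := one_lt_ratio h
  have h1 := monotone_ofLine hu
  rw [ofLine_breakPoint h] at h1
  have h3 : AM.fb x₀ y₀ false (ofLine u) = (1 - y₀) / (1 - x₀) * (ofLine u - 1) + 1 :=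
    f0_of_ge h h1
  have h4 : (1 - y₀) / (1 - x₀) * (1 - ofLine u) ≤ 1 - y₀ := by
    rw [div_mul_eq_mul_div, div_le_iff₀ (by linarith [h.2.1])]
    exact mul_le_mul_of_nonneg_left (by linarith) (by linarith [h.2.1, h.2.2.2])
  rw [liftMap, h3, toLine_of_ge (by linarith [h.2.2.1]),
    ofLine_of_nonneg ((breakPoint_pos h).le.trans hu),
    show 2 * (1 - ((1 - y₀) / (1 - x₀) * (1 - Real.exp (-u) / 2 - 1) + 1)) =
      (1 - y₀) / (1 - x₀) * Real.exp (-u) by ring,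
    Real.log_mul (by linarith) (Real.exp_pos _).ne', Real.log_exp]
  ring

theorem liftMap_false_of_mem (h : AM.A1 x₀ y₀) {u : ℝ} (hu : u ≤ breakPoint x₀) :
    liftMap x₀ y₀ false u = toLine (y₀ / x₀ * ofLine u) := by
  have h1 := monotone_ofLine hu
  rw [ofLine_breakPoint h] at h1
  exact congrArg toLine (f0_of_le h1)

theorem liftMap_false_sub_le (h : AM.A1 x₀ y₀) {w u v κ : ℝ} (hw : 0 ≤ w) (hwu : w ≤ u)
    (huv : u ≤ v) (hv : v ≤ breakPoint x₀) (hκ1 : κ ≤ 1) (h1 : 1 - ofLine w ≤ κ * ofLine w)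
    (h2 : y₀ / x₀ * (1 - ofLine w) ≤ κ * (1 - y₀ / x₀ * ofLine w)) :
    liftMap x₀ y₀ false v - liftMap x₀ y₀ false u ≤ κ * (v - u) := by
  have ha := ratio_mem h
  have h3 := toLine_mul_sub_le ha.1 ha.2 (half_le_ofLine hw) (monotone_ofLine hwu)
    (monotone_ofLine huv) (ofLine_mem v).2 hκ1 h1 h2
  rwa [toLine_ofLine, toLine_ofLine, ← liftMap_false_of_mem h hv,
    ← liftMap_false_of_mem h (huv.trans hv)] at h3

theorem monotone_of_three {f : ℝ → ℝ} {a c : ℝ} (hac : a ≤ c) (h1 : MonotoneOn f (Iic a))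
    (h2 : MonotoneOn f (Icc a c)) (h3 : MonotoneOn f (Ici c)) : Monotone f := by
  refine MonotoneOn.Iic_union_Ici (a := c) ?_ h3
  have h4 := h1.union_right h2 isGreatest_Iic (isLeast_Icc hac)
  rwa [Iic_union_Icc_eq_Iic hac] at h4

theorem monotone_liftMap_false (h : AM.A1 x₀ y₀) : Monotone (liftMap x₀ y₀ false) := by
  have ha := ratio_mem h
  refine monotone_of_three (breakPoint_pos h).le (fun u hu v hv huv => ?_)
    (fun u hu v hv huv => ?_) fun u hu v hv huv => ?_
  · rw [liftMap_false_of_nonpos h hu, liftMap_false_of_nonpos h hv]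
    linarith
  · rw [liftMap_false_of_mem h hu.2, liftMap_false_of_mem h hv.2]
    have h1 := ofLine_mem u
    have h2 := ofLine_mem v
    refine monotoneOn_toLine ⟨mul_pos ha.1 h1.1, ?_⟩ ⟨mul_pos ha.1 h2.1, ?_⟩
      (mul_le_mul_of_nonneg_left (monotone_ofLine huv) ha.1.le)
    · nlinarith [ha.1, ha.2, h1.1, h1.2]
    · nlinarith [ha.1, ha.2, h2.1, h2.2]
  · rw [liftMap_false_of_ge h hu, liftMap_false_of_ge h hv]
    linarith

theorem monotone_sub_liftMap_false (h : AM.A1 x₀ y₀) :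
    Monotone fun u => u - liftMap x₀ y₀ false u := by
  have ha := ratio_mem h
  refine monotone_of_three (breakPoint_pos h).le (fun u hu v hv huv => ?_)
    (fun u hu v hv huv => ?_) fun u hu v hv huv => ?_
  · simp only [liftMap_false_of_nonpos h hu, liftMap_false_of_nonpos h hv]
    linarith
  · have h1 : ofLine 0 = 1 / 2 := by rw [ofLine_of_nonpos le_rfl, Real.exp_zero]
    have h2 := liftMap_false_sub_le h le_rfl hu.1 huv hv.2 le_rfl (by rw [h1]; norm_num)
      (by rw [h1]; linarith [ha.2])
    linarith
  · simp only [liftMap_false_of_ge h hu, liftMap_false_of_ge h hv]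
    linarith

theorem abs_liftMap_sub_le (h : AM.A1 x₀ y₀) (i : Bool) (u v : ℝ) :
    |liftMap x₀ y₀ i u - liftMap x₀ y₀ i v| ≤ |u - v| := by
  have key := abs_sub_le_of_monotone (monotone_liftMap_false h) (monotone_sub_liftMap_false h)
  cases i
  · exact key u v
  · rw [← Bool.not_false, liftMap_not, liftMap_not, ← abs_neg (u - v)]
    have := key (-v) (-u)
    rwa [show -liftMap x₀ y₀ false (-u) - -liftMap x₀ y₀ false (-v) =
      liftMap x₀ y₀ false (-v) - liftMap x₀ y₀ false (-u) by ring,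
      show -(u - v) = -u - -v by ring, abs_sub_comm (-u)]

/-- Some composition of the maps is a contraction near `u`. -/
def ContractsAt (F : Bool → ℝ → ℝ) (u : ℝ) : Prop :=
  ∃ (w : List Bool) (r θ : ℝ), 0 < r ∧ 0 < θ ∧ θ < 1 ∧ ∀ v v',
    |v - u| < r → |v' - u| < r → |run F w v - run F w v'| ≤ θ * |v - v'|

theorem contractsAt_of_map (h : AM.A1 x₀ y₀) (i : Bool) {u : ℝ}
    (hu : ContractsAt (liftMap x₀ y₀) (liftMap x₀ y₀ i u)) : ContractsAt (liftMap x₀ y₀) u := by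
  obtain ⟨w, r, θ, hr, hθ, hθ1, hw⟩ := hu
  refine ⟨i :: w, r, θ, hr, hθ, hθ1, fun v v' hv hv' => ?_⟩
  refine (hw _ _ ((abs_liftMap_sub_le h i v u).trans_lt hv)
    ((abs_liftMap_sub_le h i v' u).trans_lt hv')).trans ?_
  exact mul_le_mul_of_nonneg_left (abs_liftMap_sub_le h i v v') hθ.le

theorem contractsAt_of_neg {u : ℝ} (hu : ContractsAt (liftMap x₀ y₀) (-u)) :
    ContractsAt (liftMap x₀ y₀) u := by
  obtain ⟨w, r, θ, hr, hθ, hθ1, hw⟩ := hu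
  refine ⟨w.map not, r, θ, hr, hθ, hθ1, fun v v' hv hv' => ?_⟩
  have e : ∀ a c : ℝ, |-a - -c| = |a - c| := fun a c => by
    rw [← abs_neg]
    ring_nf
  have h1 := hw (-v) (-v') (by rwa [e]) (by rwa [e])
  rwa [e, ← e, ← run_liftMap_not, ← run_liftMap_not] at h1

theorem contractsAt_of_mem_Ioo (h : AM.A1 x₀ y₀) {u : ℝ} (hu : u ∈ Ioo 0 (breakPoint x₀)) :
    ContractsAt (liftMap x₀ y₀) u := by
  have ha := ratio_mem h
  obtain ⟨hu0, huH⟩ := hu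
  set a : ℝ := y₀ / x₀ with hadef
  set ξ : ℝ := ofLine (u / 2) with hξ
  have hξ1 : ξ < 1 := (ofLine_mem _).2
  have hξ2 : 1 / 2 < ξ := by
    rw [hξ, ofLine_of_nonneg (by linarith)]
    have := Real.exp_lt_one_iff.2 (show -(u / 2) < 0 by linarith)
    linarith
  have haξ : 0 < 1 - a * ξ := by nlinarith [ha.1, ha.2]
  have hξ0 : 0 < ξ := by linarith
  set κ : ℝ := max ((1 - ξ) / ξ) (a * (1 - ξ) / (1 - a * ξ)) with hκ
  have hκ0 : 0 < κ := lt_max_of_lt_left (div_pos (by linarith) hξ0)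
  have hκ1 : κ < 1 := by
    refine max_lt ?_ ?_
    · rw [div_lt_one hξ0]
      linarith
    · rw [div_lt_one haξ]
      linarith [ha.2]
  have hk1 : 1 - ξ ≤ κ * ξ := by
    rw [← div_le_iff₀ hξ0]
    exact le_max_left _ _
  have hk2 : a * (1 - ξ) ≤ κ * (1 - a * ξ) := by
    rw [← div_le_iff₀ haξ]
    exact le_max_right _ _
  have key : ∀ v v', |v - u| < min (u / 2) (breakPoint x₀ - u) →
      |v' - u| < min (u / 2) (breakPoint x₀ - u) → v ≤ v' →
      |liftMap x₀ y₀ false v - liftMap x₀ y₀ false v'| ≤ κ * |v - v'| := by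
    intro v v' hv hv' hvv
    have h1 := abs_lt.1 (lt_of_lt_of_le hv (min_le_left _ _))
    have h2 := abs_lt.1 (lt_of_lt_of_le hv' (min_le_right _ _))
    have h3 := liftMap_false_sub_le h (w := u / 2) (u := v) (v := v') (κ := κ) (by linarith)
      (by linarith) hvv (by linarith) hκ1.le hk1 hk2
    have h4 := monotone_liftMap_false h hvv
    rw [abs_of_nonpos (by linarith), abs_of_nonpos (by linarith)]
    linarith
  refine ⟨[false], min (u / 2) (breakPoint x₀ - u), κ,
    lt_min (by linarith) (by linarith), hκ0, hκ1, fun v v' hv hv' => ?_⟩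
  simp only [run]
  rcases le_total v v' with hvv | hvv
  · exact key v v' hv hv' hvv
  · rw [abs_sub_comm, abs_sub_comm v]
    exact key v' v hv' hv hvv

theorem log_ratio_mem (h : AM.A1 x₀ y₀) : Real.log (y₀ / x₀) ∈ Ioo (-breakPoint x₀) 0 := by
  have ha := ratio_mem h
  refine ⟨?_, Real.log_neg ha.1 ha.2⟩
  obtain ⟨h1, h2, h3, h4⟩ := h
  rw [breakPoint, neg_neg]
  refine Real.log_lt_log (by linarith) ?_
  rw [lt_div_iff₀ (by linarith)]
  nlinarith [sq_nonneg (2 * x₀ - 1)]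

theorem log_ratio_le_breakPoint (h : AM.A1 x₀ y₀) :
    Real.log ((1 - y₀) / (1 - x₀)) ≤ breakPoint x₀ := by
  obtain ⟨h1, h2, h3, h4⟩ := h
  rw [breakPoint, ← Real.log_inv]
  refine Real.log_le_log (div_pos (by linarith) (by linarith)) ?_
  rw [div_le_iff₀ (by linarith), mul_inv]
  have : (1 - x₀)⁻¹ * (1 - x₀) = 1 := inv_mul_cancel₀ (by linarith)
  rw [mul_assoc, this]
  linarith

theorem contractsAt_zero (h : AM.A1 x₀ y₀) : ContractsAt (liftMap x₀ y₀) 0 := by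
  have h1 := log_ratio_mem h
  refine contractsAt_of_map h false (contractsAt_of_neg (contractsAt_of_mem_Ioo h ?_))
  rw [liftMap_false_of_nonpos h le_rfl, zero_add]
  exact ⟨by linarith [h1.2], by linarith [h1.1]⟩

theorem contractsAt_of_nonneg (h : AM.A1 x₀ y₀) {u : ℝ} (hu : 0 ≤ u) :
    ContractsAt (liftMap x₀ y₀) u := by
  have ht := Real.log_pos (one_lt_ratio h)
  have htH := log_ratio_le_breakPoint h
  set t : ℝ := Real.log ((1 - y₀) / (1 - x₀)) with htdef
  have key : ∀ n : ℕ, ∀ u, 0 ≤ u → u < breakPoint x₀ + n * t →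
      ContractsAt (liftMap x₀ y₀) u := by
    intro n
    induction n with
    | zero =>
      intro u hu hun
      rcases hu.eq_or_lt with rfl | hu
      · exact contractsAt_zero h
      · exact contractsAt_of_mem_Ioo h ⟨hu, by simpa using hun⟩
    | succ n ih =>
      intro u hu hun
      rcases lt_or_ge u (breakPoint x₀) with hlt | hge
      · exact ih u hu (by have : 0 ≤ n * t := by positivity
                          linarith)
      · refine contractsAt_of_map h false ?_
        rw [liftMap_false_of_ge h hge]
        push_cast at hun
        exact ih _ (by linarith) (by linarith)
  obtain ⟨n, hn⟩ := exists_nat_gt (u / t)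
  rw [div_lt_iff₀ ht] at hn
  exact key n u hu (by linarith [breakPoint_pos h])

theorem contractsAt_liftMap (h : AM.A1 x₀ y₀) (u : ℝ) : ContractsAt (liftMap x₀ y₀) u := by
  rcases le_total 0 u with hu | hu
  · exact contractsAt_of_nonneg h hu
  · exact contractsAt_of_neg (contractsAt_of_nonneg h (by linarith))

end LiftMap

/-- The weights of the system in the logarithmic coordinate. -/
noncomputable def liftWeight (p₀ p₁ : ℝ → ℝ) (i : Bool) (u : ℝ) : ℝ :=
  if i then p₁ (ofLine u) else p₀ (ofLine u)

theorem exists_exp_drift {P Q s t : ℝ} (hPQ : P + Q = 1) (h : P * s < Q * t) :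
    ∀ᶠ α in 𝓝[>] (0 : ℝ), P * Real.exp (α * s) + Q * Real.exp (-(α * t)) < 1 := by
  have hd : HasDerivAt (fun α => P * Real.exp (α * s) + Q * Real.exp (-(α * t)))
      (P * (Real.exp (0 * s) * (1 * s)) + Q * (Real.exp (-(0 * t)) * -(1 * t))) 0 :=
    ((((hasDerivAt_id (0 : ℝ)).mul_const s).exp).const_mul P).add
      (((((hasDerivAt_id (0 : ℝ)).mul_const t).neg).exp).const_mul Q)
  have h1 := (hasDerivWithinAt_iff_tendsto_slope' (lt_irrefl 0)).1
    (hd.hasDerivWithinAt (s := Ioi 0))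
  have h2 : P * (Real.exp (0 * s) * (1 * s)) + Q * (Real.exp (-(0 * t)) * -(1 * t)) < 0 := by
    simp only [zero_mul, neg_zero, Real.exp_zero, one_mul]
    linarith
  have h3 := h1.eventually (gt_mem_nhds h2)
  filter_upwards [h3, self_mem_nhdsWithin] with α hα hα0
  rw [slope_def_field, sub_zero, div_neg_iff] at hα
  rcases hα with ⟨-, hα⟩ | ⟨hα, -⟩
  · exact absurd hα (not_lt.2 (le_of_lt hα0))
  · simp only [zero_mul, neg_zero, Real.exp_zero, mul_one] at hα
    linarith

section LiftWeight

variable {x₀ y₀ : ℝ} {p₀ p₁ : ℝ → ℝ}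

theorem ofLine_mem_Icc (u : ℝ) : ofLine u ∈ Icc (0 : ℝ) 1 := Ioo_subset_Icc_self (ofLine_mem u)

theorem isWeight_liftWeight (h : AM.A3 p₀ p₁) : IsWeight (liftWeight p₀ p₁) where
  nonneg i u := by
    have := h.2.2 _ (ofLine_mem_Icc u)
    cases i
    · exact this.2.1.le
    · exact this.2.2.2.1.le
  sum_one u := by
    rw [Fintype.sum_bool, add_comm]
    exact (h.2.2 _ (ofLine_mem_Icc u)).1

theorem exists_le_liftWeight (h : AM.A3 p₀ p₁) :
    ∃ ε > 0, ∀ i u, ε ≤ liftWeight p₀ p₁ i u := by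
  have hne : (Icc (0 : ℝ) 1).Nonempty := ⟨0, by simp⟩
  obtain ⟨x, hx, hxm⟩ := isCompact_Icc.exists_isMinOn hne h.1
  obtain ⟨y, hy, hym⟩ := isCompact_Icc.exists_isMinOn hne h.2.1
  refine ⟨min (p₀ x) (p₁ y), lt_min (h.2.2 x hx).2.1 (h.2.2 y hy).2.2.2.1, fun i u => ?_⟩
  cases i
  · exact (min_le_left _ _).trans (hxm (ofLine_mem_Icc u))
  · exact (min_le_right _ _).trans (hym (ofLine_mem_Icc u))

/-- The least modulus of continuity of the weights in the logarithmic coordinate. -/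
noncomputable def liftModulus (p₀ : ℝ → ℝ) (t : ℝ) : ℝ :=
  sSup ((fun z : ℝ × ℝ => |p₀ (ofLine z.1) - p₀ (ofLine z.2)|) '' {z | |z.1 - z.2| ≤ t})

theorem bddAbove_liftModulus (h : AM.A3 p₀ p₁) (t : ℝ) :
    BddAbove ((fun z : ℝ × ℝ => |p₀ (ofLine z.1) - p₀ (ofLine z.2)|) ''
      {z | |z.1 - z.2| ≤ t}) := by
  refine ⟨1, ?_⟩
  rintro _ ⟨z, -, rfl⟩
  have h1 := h.2.2 _ (ofLine_mem_Icc z.1)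
  have h2 := h.2.2 _ (ofLine_mem_Icc z.2)
  simp only
  rw [abs_le]
  constructor <;> linarith

theorem abs_sub_le_liftModulus (h : AM.A3 p₀ p₁) {u v t : ℝ} (huv : |u - v| ≤ t) :
    |p₀ (ofLine u) - p₀ (ofLine v)| ≤ liftModulus p₀ t :=
  le_csSup (bddAbove_liftModulus h t) ⟨(u, v), huv, rfl⟩

theorem liftModulus_nonneg (t : ℝ) : 0 ≤ liftModulus p₀ t := by
  refine Real.sSup_nonneg ?_
  rintro _ ⟨z, -, rfl⟩
  exact abs_nonneg _

theorem liftModulus_mono (h : AM.A3 p₀ p₁) {s t : ℝ} (hs : 0 ≤ s) (hst : s ≤ t) :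
    liftModulus p₀ s ≤ liftModulus p₀ t :=
  csSup_le_csSup (bddAbove_liftModulus h t)
    (Set.Nonempty.image _ ⟨(0, 0), by simpa using hs⟩)
    (image_mono fun _ hz => le_trans hz hst)

theorem liftModulus_dini (h : AM.A2 p₀ p₁) {C t : ℝ} (hC : 0 ≤ C) (ht : 0 < t) (ht1 : t < 1) :
    Summable fun n : ℕ => liftModulus p₀ (C * t ^ n) := by
  obtain ⟨β, hβ, hs⟩ := h
  refine Summable.of_nonneg_of_le (fun n => liftModulus_nonneg _) (fun n => ?_) (hs C hC t ht ht1)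
  have h0 : 0 ≤ C * t ^ n := by positivity
  refine csSup_le (Set.Nonempty.image _ ⟨(0, 0), by simpa using h0⟩) ?_
  rintro _ ⟨z, hz, rfl⟩
  exact (hβ _ _ (ofLine_mem_Icc _) _ (ofLine_mem_Icc _)
    ((abs_ofLine_sub_le z.1 z.2).trans hz)).1

theorem abs_liftWeight_sub_le (h : AM.A3 p₀ p₁) (i : Bool) (u v : ℝ) :
    |liftWeight p₀ p₁ i u - liftWeight p₀ p₁ i v| ≤ liftModulus p₀ |u - v| := by
  cases i
  · exact abs_sub_le_liftModulus h le_rfl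
  · have h1 := (h.2.2 _ (ofLine_mem_Icc u)).1
    have h2 := (h.2.2 _ (ofLine_mem_Icc v)).1
    have h3 : p₁ (ofLine u) - p₁ (ofLine v) = -(p₀ (ofLine u) - p₀ (ofLine v)) := by linarith
    have h4 := abs_sub_le_liftModulus h (le_refl |u - v|)
    rw [← abs_neg, ← h3] at h4
    exact h4

theorem exists_drift (h1 : AM.A1 x₀ y₀) (h3 : AM.A3 p₀ p₁) (h4 : AM.A4 x₀ y₀ p₀ p₁) :
    ∃ α > 0, ∃ l b : ℝ, 0 ≤ l ∧ l < 1 ∧ 0 ≤ b ∧ ∀ u,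
      mop (liftMap x₀ y₀) (liftWeight p₀ p₁) (fun u => Real.exp (α * |u|)) u ≤
        l * Real.exp (α * |u|) + b * (1 - l) := by
  have hs := (log_ratio_mem h1).2
  set s : ℝ := -Real.log (y₀ / x₀) with hsdef
  have ht := Real.log_pos (one_lt_ratio h1)
  have hft : ∀ u, liftMap x₀ y₀ true u = -liftMap x₀ y₀ false (-u) :=
    fun u => liftMap_not false u
  have hlow : ∀ u ≤ 0, liftMap x₀ y₀ false u = u - s := fun u hu => by
    rw [liftMap_false_of_nonpos h1 hu, hsdef]
    ring
  have hhigh := fun u hu => liftMap_false_of_ge h1 (u := u) hu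
  have htH := log_ratio_le_breakPoint h1
  set t : ℝ := Real.log ((1 - y₀) / (1 - x₀)) with htdef
  have hz : (0 : ℝ) ∈ Icc (0 : ℝ) 1 := by simp
  have ho : (1 : ℝ) ∈ Icc (0 : ℝ) 1 := by simp
  obtain ⟨hA, hB⟩ := h4
  rw [show Real.log (y₀ / x₀) = -s by rw [hsdef, neg_neg]] at hA hB
  obtain ⟨α, ⟨hα1, hα2⟩, hα⟩ := (((exists_exp_drift (P := p₀ 0) (Q := p₁ 0) (s := s) (t := t)
    (h3.2.2 0 hz).1 (by linarith)).and (exists_exp_drift (P := p₁ 1) (Q := p₀ 1) (s := s) (t := t)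
    (by linarith [(h3.2.2 1 ho).1]) (by linarith))).and self_mem_nhdsWithin).exists
  obtain ⟨l, hl, hl1⟩ := exists_between (max_lt hα1 hα2)
  have hP0 := (h3.2.2 0 hz).2
  have hl0 : 0 ≤ l := by
    have := (le_max_left _ _).trans hl.le
    have h5 : 0 ≤ p₀ 0 * Real.exp (α * s) := mul_nonneg hP0.1.le (Real.exp_pos _).le
    have h6 : 0 ≤ p₁ 0 * Real.exp (-(α * t)) := mul_nonneg hP0.2.2.1.le (Real.exp_pos _).le
    linarith
  have htop : Tendsto ofLine atTop (𝓝[Icc 0 1] 1) :=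
    tendsto_nhdsWithin_iff.2 ⟨tendsto_ofLine_atTop, Eventually.of_forall ofLine_mem_Icc⟩
  have hbot : Tendsto ofLine atBot (𝓝[Icc 0 1] 0) :=
    tendsto_nhdsWithin_iff.2 ⟨tendsto_ofLine_atBot, Eventually.of_forall ofLine_mem_Icc⟩
  have e1 : ∀ᶠ u in atBot, p₀ (ofLine u) * Real.exp (α * s) +
      p₁ (ofLine u) * Real.exp (-(α * t)) < l :=
    ((((h3.1 0 hz).tendsto.comp hbot).mul_const _).add
      (((h3.2.1 0 hz).tendsto.comp hbot).mul_const _)).eventually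
      (gt_mem_nhds ((le_max_left _ _).trans_lt hl))
  have e2 : ∀ᶠ u in atTop, p₁ (ofLine u) * Real.exp (α * s) +
      p₀ (ofLine u) * Real.exp (-(α * t)) < l :=
    ((((h3.2.1 1 ho).tendsto.comp htop).mul_const _).add
      (((h3.1 1 ho).tendsto.comp htop).mul_const _)).eventually
      (gt_mem_nhds ((le_max_right _ _).trans_lt hl))
  obtain ⟨k₁, hk₁⟩ := eventually_atBot.1 e1
  obtain ⟨k₂, hk₂⟩ := eventually_atTop.1 e2
  have hH := breakPoint_pos h1
  set H := breakPoint x₀ with hHdef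
  set k : ℝ := max H (max (-k₁) k₂) with hk
  have hkH : H ≤ k := le_max_left _ _
  have hkk₁ : -k₁ ≤ k := (le_max_left _ _).trans (le_max_right _ _)
  have hkk₂ : k₂ ≤ k := (le_max_right _ _).trans (le_max_right _ _)
  have hW := isWeight_liftWeight h3
  set c : ℝ := max |liftMap x₀ y₀ true 0| |liftMap x₀ y₀ false 0| with hc
  have hcb : ∀ i, |liftMap x₀ y₀ i 0| ≤ c := fun i => by
    cases i
    · exact le_max_right _ _
    · exact le_max_left _ _
  refine ⟨α, hα, l, Real.exp (α * (k + c)) / (1 - l), hl0, hl1,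
    div_nonneg (Real.exp_pos _).le (by linarith), fun u => ?_⟩
  rw [div_mul_cancel₀ _ (show 1 - l ≠ 0 by linarith)]
  rcases le_or_gt |u| k with hu | hu
  · have h5 : mop (liftMap x₀ y₀) (liftWeight p₀ p₁) (fun u => Real.exp (α * |u|)) u ≤
        ∑ i, liftWeight p₀ p₁ i u * Real.exp (α * (k + c)) := by
      refine Finset.sum_le_sum fun i _ => mul_le_mul_of_nonneg_left ?_ (hW.nonneg i u)
      have h6 := abs_liftMap_sub_le h1 i u 0
      rw [sub_zero] at h6
      have h7 := abs_sub_abs_le_abs_sub (liftMap x₀ y₀ i u) (liftMap x₀ y₀ i 0)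
      have h8 := hcb i
      exact Real.exp_le_exp.2 (mul_le_mul_of_nonneg_left (by linarith) hα.le)
    rw [← Finset.sum_mul, hW.sum_one, one_mul] at h5
    have : 0 ≤ l * Real.exp (α * |u|) := mul_nonneg hl0 (Real.exp_pos _).le
    linarith
  · have h9 := Real.exp_pos (α * (k + c))
    rcases le_total 0 u with hu0 | hu0
    · rw [abs_of_nonneg hu0] at hu ⊢
      have f0 : liftMap x₀ y₀ false u = u - t := hhigh u (by linarith)
      have f1 : liftMap x₀ y₀ true u = u + s := by
        rw [hft, hlow _ (by linarith)]
        ring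
      simp only [mop, Fintype.sum_bool, f0, f1]
      rw [abs_of_nonneg (by linarith), abs_of_nonneg (by linarith)]
      have h5 := mul_le_mul_of_nonneg_right (hk₂ u (by linarith)).le (Real.exp_pos (α * u)).le
      rw [mul_add, mul_sub, sub_eq_add_neg (α * u), Real.exp_add, Real.exp_add]
      simp only [liftWeight, if_true, Bool.false_eq_true, if_false]
      linarith
    · rw [abs_of_nonpos hu0] at hu ⊢
      have f0 : liftMap x₀ y₀ false u = u - s := hlow u hu0
      have f1 : liftMap x₀ y₀ true u = u + t := by
        rw [hft, hhigh _ (by linarith)]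
        ring
      simp only [mop, Fintype.sum_bool, f0, f1]
      rw [abs_of_nonpos (by linarith), abs_of_nonpos (by linarith)]
      have h5 := mul_le_mul_of_nonneg_right (hk₁ u (by linarith)).le (Real.exp_pos (α * -u)).le
      rw [show α * -(u + t) = α * -u + -(α * t) by ring,
        show α * -(u - s) = α * -u + α * s by ring, Real.exp_add, Real.exp_add]
      simp only [liftWeight, if_true, Bool.false_eq_true, if_false]
      linarith

theorem exists_lineSystem (h1 : AM.A1 x₀ y₀) (h2 : AM.A2 p₀ p₁) (h3 : AM.A3 p₀ p₁)
    (h4 : AM.A4 x₀ y₀ p₀ p₁) :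
    ∃ (V β : ℝ → ℝ) (ε l b : ℝ), LineSystem (liftMap x₀ y₀) (liftWeight p₀ p₁) V β ε l b := by
  obtain ⟨ε, hε, hεq⟩ := exists_le_liftWeight h3
  obtain ⟨α, hα, l, b, hl, hl1, hb, hd⟩ := exists_drift h1 h3 h4
  exact ⟨fun u => Real.exp (α * |u|), liftModulus p₀, ε, l, b,
    { weight := isWeight_liftWeight h3
      eps_pos := hε
      eps_le := hεq
      nonexp := abs_liftMap_sub_le h1
      beta_nonneg := fun t _ => liftModulus_nonneg t
      beta_mono := fun _ _ hs hst => liftModulus_mono h3 hs hst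
      modulus := abs_liftWeight_sub_le h3
      dini := fun _ _ hC ht ht1 => liftModulus_dini h2 hC ht ht1
      V_nonneg := fun _ => (Real.exp_pos _).le
      V_proper := fun M => ⟨M / α, fun u hu => by
        rw [le_div_iff₀ hα]
        have := Real.add_one_le_exp (α * |u|)
        linarith⟩
      V_bdd := fun m => ⟨Real.exp (α * m), fun u hu =>
        Real.exp_le_exp.2 (mul_le_mul_of_nonneg_left hu hα.le)⟩
      l_nonneg := hl
      l_lt := hl1
      b_nonneg := hb
      drift := hd
      contr := contractsAt_liftMap h1 }⟩

end LiftWeight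

section Stability

variable {x₀ y₀ : ℝ} {p₀ p₁ : ℝ → ℝ}

theorem U_iterate_eq (h : AM.A1 x₀ y₀) (φ : ℝ → ℝ) (n : ℕ) :
    ∀ x ∈ Ioo (0 : ℝ) 1, (AM.U x₀ y₀ p₀ p₁)^[n] φ x =
      (mop (liftMap x₀ y₀) (liftWeight p₀ p₁))^[n] (φ ∘ ofLine) (toLine x) := by
  induction n with
  | zero =>
    intro x hx
    simp [ofLine_toLine hx]
  | succ n ih =>
    intro x hx
    rw [Function.iterate_succ_apply', Function.iterate_succ_apply']
    have e : ∀ i, liftMap x₀ y₀ i (toLine x) = toLine (AM.fb x₀ y₀ i x) := fun i => by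
      rw [liftMap, ofLine_toLine hx]
    generalize (mop (liftMap x₀ y₀) (liftWeight p₀ p₁))^[n] (φ ∘ ofLine) = χ at ih ⊢
    simp only [mop, Fintype.sum_bool, e, liftWeight, ofLine_toLine hx]
    rw [← ih _ (fb_mem h true hx), ← ih _ (fb_mem h false hx), add_comm]
    rfl

theorem tendsto_U_iterate_sub (h1 : AM.A1 x₀ y₀) (h2 : AM.A2 p₀ p₁) (h3 : AM.A3 p₀ p₁)
    (h4 : AM.A4 x₀ y₀ p₀ p₁) {φ : ℝ → ℝ} (hφ : ContinuousOn φ (Ioo 0 1)) {K : ℝ}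
    (hK : ∀ t ∈ Ioo (0 : ℝ) 1, |φ t| ≤ K) {x y : ℝ} (hx : x ∈ Ioo (0 : ℝ) 1)
    (hy : y ∈ Ioo (0 : ℝ) 1) :
    Tendsto (fun n => (AM.U x₀ y₀ p₀ p₁)^[n] φ x - (AM.U x₀ y₀ p₀ p₁)^[n] φ y) atTop (𝓝 0) := by
  obtain ⟨V, β, ε, l, b, h⟩ := exists_lineSystem h1 h2 h3 h4
  have := h.tendsto_mop_iterate_sub (hφ.comp_continuous continuous_ofLine ofLine_mem)
    (fun u => hK _ (ofLine_mem u)) (toLine x) (toLine y)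
  refine this.congr fun n => ?_
  rw [U_iterate_eq h1 φ n x hx, U_iterate_eq h1 φ n y hy]

/-- Functions which are continuous on `(0,1)` and bounded there by `K`. -/
def BoundedContinuousOn (K : ℝ) (φ : ℝ → ℝ) : Prop :=
  ContinuousOn φ (Ioo 0 1) ∧ ∀ t ∈ Ioo (0 : ℝ) 1, |φ t| ≤ K

theorem continuousOn_comp_fb (h : AM.A1 x₀ y₀) {φ : ℝ → ℝ} (hφ : ContinuousOn φ (Ioo 0 1))
    (i : Bool) : ContinuousOn (fun x => φ (AM.fb x₀ y₀ i x)) (Ioo 0 1) :=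
  hφ.comp (continuous_fb h i).continuousOn fun _ hx => fb_mem h i hx

theorem BoundedContinuousOn.U (h1 : AM.A1 x₀ y₀) (h3 : AM.A3 p₀ p₁) {K : ℝ} {φ : ℝ → ℝ}
    (hφ : BoundedContinuousOn K φ) : BoundedContinuousOn K (AM.U x₀ y₀ p₀ p₁ φ) := by
  refine ⟨((h3.1.mono Ioo_subset_Icc_self).mul (continuousOn_comp_fb h1 hφ.1 false)).add
    ((h3.2.1.mono Ioo_subset_Icc_self).mul (continuousOn_comp_fb h1 hφ.1 true)), fun x hx => ?_⟩
  obtain ⟨hs, h0, -, h1', -⟩ := h3.2.2 x (Ioo_subset_Icc_self hx)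
  have e0 := abs_le.1 (hφ.2 _ (fb_mem h1 false hx))
  have e1 := abs_le.1 (hφ.2 _ (fb_mem h1 true hx))
  have e : AM.U x₀ y₀ p₀ p₁ φ x =
    p₀ x * φ (AM.fb x₀ y₀ false x) + p₁ x * φ (AM.fb x₀ y₀ true x) := rfl
  have hK : K = p₀ x * K + p₁ x * K := by rw [← add_mul, hs, one_mul]
  rw [e, abs_le]
  constructor
  · nlinarith
  · nlinarith

theorem BoundedContinuousOn.U_iterate (h1 : AM.A1 x₀ y₀) (h3 : AM.A3 p₀ p₁) {K : ℝ}
    {φ : ℝ → ℝ} (hφ : BoundedContinuousOn K φ) (n : ℕ) :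
    BoundedContinuousOn K ((AM.U x₀ y₀ p₀ p₁)^[n] φ) := by
  induction n with
  | zero => exact hφ
  | succ n ih =>
    rw [Function.iterate_succ_apply']
    exact ih.U h1 h3

theorem BoundedContinuousOn.integrableOn {μ : Measure ℝ} [IsProbabilityMeasure μ] {K : ℝ}
    {φ : ℝ → ℝ} (hφ : BoundedContinuousOn K φ) : IntegrableOn φ (Ioo 0 1) μ := by
  refine Integrable.of_bound (hφ.1.aestronglyMeasurable measurableSet_Ioo) K ?_
  filter_upwards [ae_restrict_mem measurableSet_Ioo] with x hx
  exact hφ.2 x hx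

theorem tendsto_integral_U_iterate_sub (h1 : AM.A1 x₀ y₀) (h2 : AM.A2 p₀ p₁)
    (h3 : AM.A3 p₀ p₁) (h4 : AM.A4 x₀ y₀ p₀ p₁) {K : ℝ} {φ : ℝ → ℝ}
    (hφ : BoundedContinuousOn K φ) (ν : Measure ℝ) [IsProbabilityMeasure ν]
    (hν : ν (Ioo 0 1) = 1) {y : ℝ} (hy : y ∈ Ioo (0 : ℝ) 1) :
    Tendsto (fun n => (∫ x in Ioo (0 : ℝ) 1, (AM.U x₀ y₀ p₀ p₁)^[n] φ x ∂ν) -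
      (AM.U x₀ y₀ p₀ p₁)^[n] φ y) atTop (𝓝 0) := by
  have hb := fun n => hφ.U_iterate h1 h3 n
  have h5 : Tendsto (fun n => ∫ x in Ioo (0 : ℝ) 1,
      ((AM.U x₀ y₀ p₀ p₁)^[n] φ x - (AM.U x₀ y₀ p₀ p₁)^[n] φ y) ∂ν) atTop
      (𝓝 (∫ x in Ioo (0 : ℝ) 1, (0 : ℝ) ∂ν)) := by
    refine tendsto_integral_of_dominated_convergence (fun _ => K + K)
      (fun n => ((hb n).1.sub continuousOn_const).aestronglyMeasurable measurableSet_Ioo)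
      (integrable_const _) (fun n => ?_) ?_
    · filter_upwards [ae_restrict_mem measurableSet_Ioo] with x hx
      exact (abs_sub _ _).trans (add_le_add ((hb n).2 x hx) ((hb n).2 y hy))
    · filter_upwards [ae_restrict_mem measurableSet_Ioo] with x hx
      exact tendsto_U_iterate_sub h1 h2 h3 h4 hφ.1 hφ.2 hx hy
  rw [integral_zero] at h5
  refine h5.congr fun n => ?_
  rw [integral_sub (hb n).integrableOn (integrable_const _)]
  simp [hν, Measure.real]

theorem fb_mem_iff (h : AM.A1 x₀ y₀) (i : Bool) {x : ℝ} :
    AM.fb x₀ y₀ i x ∈ Ioo (0 : ℝ) 1 ↔ x ∈ Ioo (0 : ℝ) 1 := by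
  have key : ∀ x, AM.fb x₀ y₀ false x ∈ Ioo (0 : ℝ) 1 → x ∈ Ioo (0 : ℝ) 1 := by
    intro x hx
    have ha := ratio_mem h
    have hb := one_lt_ratio h
    have h0 := h.1
    have h1 := h.2.1
    constructor
    · by_contra hx0
      have e : AM.fb x₀ y₀ false x = y₀ / x₀ * x := f0_of_le (by linarith)
      rw [e] at hx
      have := hx.1
      nlinarith [ha.1]
    · by_contra hx1
      have e : AM.fb x₀ y₀ false x = (1 - y₀) / (1 - x₀) * (x - 1) + 1 :=
        f0_of_ge h (by linarith)
      rw [e] at hx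
      have := hx.2
      nlinarith
  refine ⟨fun hx => ?_, fb_mem h i⟩
  cases i
  · exact key x hx
  · rw [fb_true] at hx
    have := key (1 - x) ⟨by linarith [hx.2], by linarith [hx.1]⟩
    exact ⟨by linarith [this.2], by linarith [this.1]⟩

theorem stationary_restrict_eq (h1 : AM.A1 x₀ y₀) {μ : Measure ℝ}
    (hμ : AM.Stationary x₀ y₀ p₀ p₁ μ) :
    μ.restrict (Ioo 0 1) =
      ((μ.restrict (Ioo 0 1)).withDensity fun x => ENNReal.ofReal (p₀ x)).map
        (AM.fb x₀ y₀ false) +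
      ((μ.restrict (Ioo 0 1)).withDensity fun x => ENNReal.ofReal (p₁ x)).map
        (AM.fb x₀ y₀ true) := by
  have hm : ∀ i, Measurable (AM.fb x₀ y₀ i) := fun i => (continuous_fb h1 i).measurable
  ext A hA
  have hpre : ∀ i, AM.fb x₀ y₀ i ⁻¹' (A ∩ Ioo 0 1) = AM.fb x₀ y₀ i ⁻¹' A ∩ Ioo 0 1 := by
    intro i
    ext x
    simp only [mem_preimage, mem_inter_iff, fb_mem_iff h1]
  have h5 := hμ.2.2 (A ∩ Ioo 0 1) (hA.inter measurableSet_Ioo) inter_subset_right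
  have h6 : AM.Pop x₀ y₀ p₀ p₁ μ (A ∩ Ioo 0 1) =
      (∫⁻ x in AM.fb x₀ y₀ false ⁻¹' (A ∩ Ioo 0 1), ENNReal.ofReal (p₀ x) ∂μ) +
        ∫⁻ x in AM.fb x₀ y₀ true ⁻¹' (A ∩ Ioo 0 1), ENNReal.ofReal (p₁ x) ∂μ := rfl
  rw [Measure.restrict_apply hA, h5, h6, Measure.add_apply, Measure.map_apply (hm _) hA,
    Measure.map_apply (hm _) hA, withDensity_apply _ (hm _ hA), withDensity_apply _ (hm _ hA),
    Measure.restrict_restrict (hm _ hA), Measure.restrict_restrict (hm _ hA), hpre, hpre]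

theorem integral_map_withDensity (h1 : AM.A1 x₀ y₀) {μ : Measure ℝ} [IsProbabilityMeasure μ]
    {p : ℝ → ℝ} (hp : ContinuousOn p (Ioo 0 1)) (hp0 : ∀ x ∈ Ioo (0 : ℝ) 1, 0 ≤ p x) (i : Bool)
    {ψ : ℝ → ℝ} (hψ : AEStronglyMeasurable ψ
      (((μ.restrict (Ioo 0 1)).withDensity fun x => ENNReal.ofReal (p x)).map
        (AM.fb x₀ y₀ i))) :
    ∫ x, ψ x ∂(((μ.restrict (Ioo 0 1)).withDensity fun x => ENNReal.ofReal (p x)).map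
      (AM.fb x₀ y₀ i)) = ∫ x in Ioo (0 : ℝ) 1, p x * ψ (AM.fb x₀ y₀ i x) ∂μ := by
  rw [integral_map (continuous_fb h1 i).measurable.aemeasurable hψ,
    integral_withDensity_eq_integral_toReal_smul₀
      (hp.aemeasurable measurableSet_Ioo).ennreal_ofReal
      (Eventually.of_forall fun _ => ENNReal.ofReal_lt_top)]
  refine setIntegral_congr_fun measurableSet_Ioo fun x hx => ?_
  simp only [ENNReal.toReal_ofReal (hp0 x hx), smul_eq_mul]

theorem integral_U_eq (h1 : AM.A1 x₀ y₀) (h3 : AM.A3 p₀ p₁) {μ : Measure ℝ}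
    (hμ : AM.Stationary x₀ y₀ p₀ p₁ μ) {K : ℝ} {φ : ℝ → ℝ} (hφ : BoundedContinuousOn K φ) :
    ∫ x in Ioo (0 : ℝ) 1, AM.U x₀ y₀ p₀ p₁ φ x ∂μ = ∫ x in Ioo (0 : ℝ) 1, φ x ∂μ := by
  have := hμ.1
  have hφint : Integrable φ (μ.restrict (Ioo 0 1)) := hφ.integrableOn
  have hc0 := h3.1.mono Ioo_subset_Icc_self
  have hc1 := h3.2.1.mono Ioo_subset_Icc_self
  have hb : ∀ (p : ℝ → ℝ), ContinuousOn p (Ioo 0 1) →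
      (∀ x ∈ Ioo (0 : ℝ) 1, 0 ≤ p x ∧ p x ≤ 1) → ∀ i,
      BoundedContinuousOn K fun x => p x * φ (AM.fb x₀ y₀ i x) := by
    intro p hp hp1 i
    refine ⟨hp.mul (continuousOn_comp_fb h1 hφ.1 i), fun x hx => ?_⟩
    have h5 := hφ.2 _ (fb_mem h1 i hx)
    rw [abs_mul, abs_of_nonneg (hp1 x hx).1]
    exact (mul_le_of_le_one_left (abs_nonneg _) (hp1 x hx).2).trans h5
  have hp0 : ∀ x ∈ Ioo (0 : ℝ) 1, 0 ≤ p₀ x ∧ p₀ x ≤ 1 := fun x hx =>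
    have := h3.2.2 x (Ioo_subset_Icc_self hx)
    ⟨this.2.1.le, this.2.2.1.le⟩
  have hp1 : ∀ x ∈ Ioo (0 : ℝ) 1, 0 ≤ p₁ x ∧ p₁ x ≤ 1 := fun x hx =>
    have := h3.2.2 x (Ioo_subset_Icc_self hx)
    ⟨this.2.2.2.1.le, this.2.2.2.2.le⟩
  have hdec := hφint
  rw [stationary_restrict_eq h1 hμ] at hdec
  have e1 := hdec.left_of_add_measure
  have e2 := hdec.right_of_add_measure
  have e3 : ∫ x in Ioo (0 : ℝ) 1, φ x ∂μ = _ := congrArg (fun m => ∫ x, φ x ∂m)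
    (stationary_restrict_eq h1 hμ)
  rw [e3, integral_add_measure e1 e2,
    integral_map_withDensity h1 hc0 (fun x hx => (hp0 x hx).1) false e1.aestronglyMeasurable,
    integral_map_withDensity h1 hc1 (fun x hx => (hp1 x hx).1) true e2.aestronglyMeasurable,
    ← integral_add (hb p₀ hc0 hp0 false).integrableOn (hb p₁ hc1 hp1 true).integrableOn]
  rfl

theorem integral_U_iterate_eq (h1 : AM.A1 x₀ y₀) (h3 : AM.A3 p₀ p₁) {μ : Measure ℝ}
    (hμ : AM.Stationary x₀ y₀ p₀ p₁ μ) {K : ℝ} {φ : ℝ → ℝ} (hφ : BoundedContinuousOn K φ)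
    (n : ℕ) :
    ∫ x in Ioo (0 : ℝ) 1, (AM.U x₀ y₀ p₀ p₁)^[n] φ x ∂μ = ∫ x in Ioo (0 : ℝ) 1, φ x ∂μ := by
  induction n with
  | zero => rfl
  | succ n ih =>
    rw [Function.iterate_succ_apply', integral_U_eq h1 h3 hμ (hφ.U_iterate h1 h3 n), ih]

end Stability

/-- asymptotic stability: for every Borel probability measure `ν` on `(0,1)`
and every bounded continuous `φ : (0,1) → ℝ`, `∫ Uⁿφ dν → ∫ φ dμ⋆`. -/
theorem stmt1 (x₀ y₀ : ℝ) (p₀ p₁ : ℝ → ℝ)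
    (hA1 : AM.A1 x₀ y₀) (hA2 : AM.A2 p₀ p₁) (hA3 : AM.A3 p₀ p₁) (hA4 : AM.A4 x₀ y₀ p₀ p₁)
    (μstar : MeasureTheory.Measure ℝ) (hstar : AM.Stationary x₀ y₀ p₀ p₁ μstar)
    (ν : MeasureTheory.Measure ℝ) (hνp : MeasureTheory.IsProbabilityMeasure ν)
    (hν1 : ν (Set.Ioo 0 1) = 1)
    (φ : ℝ → ℝ) (hφc : ContinuousOn φ (Set.Ioo 0 1))
    (hφb : ∃ K : ℝ, ∀ t ∈ Set.Ioo (0:ℝ) 1, |φ t| ≤ K) :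
    Filter.Tendsto
      (fun n : ℕ => ∫ x in Set.Ioo (0:ℝ) 1, ((AM.U x₀ y₀ p₀ p₁)^[n] φ) x ∂ν)
      Filter.atTop (nhds (∫ t in Set.Ioo (0:ℝ) 1, φ t ∂μstar)) := by
  obtain ⟨K, hK⟩ := hφb
  have hφ : BoundedContinuousOn K φ := ⟨hφc, hK⟩
  have hy : (1 / 2 : ℝ) ∈ Ioo (0 : ℝ) 1 := by constructor <;> norm_num
  have hμp := hstar.1
  have h1 := tendsto_integral_U_iterate_sub hA1 hA2 hA3 hA4 hφ ν hν1 hy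
  have h2 := tendsto_integral_U_iterate_sub hA1 hA2 hA3 hA4 hφ μstar hstar.2.1 hy
  have h3 := (h1.sub h2).add_const (∫ t in Ioo (0 : ℝ) 1, φ t ∂μstar)
  rw [sub_zero, zero_add] at h3
  refine h3.congr fun n => ?_
  rw [integral_U_iterate_eq hA1 hA3 hstar hφ n]
  ring
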